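/- (Mostow decomposition of P.) Let E be a closed real-linear subspace of S₂(H) such that [X, [X, Y]] ∈ E for all X, Y ∈ E, and let F = E^⊥ be the orthogonal complement of E in S₂(H) with respect to the Hilbert–Schmidt inner product. Then for every p ∈ P there exist a unique e ∈ exp E and a unique f ∈ exp F such that p = e f e; moreover, the map (e, f) ↦ e f e is a homeomorphism from exp E × exp F onto P, all spaces being topologized by the Hilbert–Schmidt distance (p, q) ↦ ‖p − q‖₂. -/

import Mathlib

noncomputable section

open scoped InnerProductSpace

variable {H : Type*} [NormedAddCommGroup H] [InnerProductSpace ℂ H] [CompleteSpace H]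
variable {ι : Type*}

/-- `A` is a Hilbert–Schmidt operator (w.r.t. the Hilbert basis `e`). -/
def IsHS (e : HilbertBasis ι ℂ H) (A : H →L[ℂ] H) : Prop :=
  Summable fun i => ‖A (e i)‖ ^ 2

/-- The Hilbert–Schmidt norm of `A` (w.r.t. the Hilbert basis `e`). -/
def hsNorm (e : HilbertBasis ι ℂ H) (A : H →L[ℂ] H) : ℝ :=
  Real.sqrt (∑' i, ‖A (e i)‖ ^ 2)

/-- The real Hilbert–Schmidt inner product `⟨A, B⟩₂ = ∑ ⟪A eᵢ, B eᵢ⟫`. -/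
def hsInner (e : HilbertBasis ι ℂ H) (A B : H →L[ℂ] H) : ℝ :=
  (∑' i, (inner ℂ (A (e i)) (B (e i)) : ℂ)).re

/-- The trace of an operator, `Tr T = ∑ ⟪eᵢ, T eᵢ⟫`. -/
def opTrace (e : HilbertBasis ι ℂ H) (T : H →L[ℂ] H) : ℂ :=
  ∑' i, (inner ℂ (e i) (T (e i)) : ℂ)

/-- `T` is trace class: it is the product of two Hilbert–Schmidt operators. -/
def IsTraceClass (e : HilbertBasis ι ℂ H) (T : H →L[ℂ] H) : Prop :=
  ∃ B C : H →L[ℂ] H, IsHS e B ∧ IsHS e C ∧ T = B * C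

/-- `A ∈ S₂(H)`: self-adjoint and Hilbert–Schmidt. -/
def MemS2 (e : HilbertBasis ι ℂ H) (A : H →L[ℂ] H) : Prop :=
  IsSelfAdjoint A ∧ IsHS e A

/-- `p ∈ P`: self-adjoint, positive definite (invertible and `⟪p x, x⟫ ≥ 0`),
with `p - 1` Hilbert–Schmidt. -/
def MemP (e : HilbertBasis ι ℂ H) (p : H →L[ℂ] H) : Prop :=
  IsSelfAdjoint p ∧ IsUnit p ∧ (∀ x : H, 0 ≤ (inner ℂ (p x) x : ℂ).re) ∧ IsHS e (p - 1)

/-- `x ∈ GL₂(H)`: invertible with `x - 1` Hilbert–Schmidt. -/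
def MemGL2 (e : HilbertBasis ι ℂ H) (x : H →L[ℂ] H) : Prop :=
  IsUnit x ∧ IsHS e (x - 1)

/-- `x ∈ U₂(H)`: unitary with `x - 1` Hilbert–Schmidt. -/
def MemU2 (e : HilbertBasis ι ℂ H) (x : H →L[ℂ] H) : Prop :=
  x ∈ unitary (H →L[ℂ] H) ∧ IsHS e (x - 1)

/-- `p^{1/2}`, via continuous functional calculus. -/
def psqrt (p : H →L[ℂ] H) : H →L[ℂ] H := cfc Real.sqrt p

/-- `p^{-1/2}`, via continuous functional calculus. -/
def pinvsqrt (p : H →L[ℂ] H) : H →L[ℂ] H := cfc (fun t : ℝ => (Real.sqrt t)⁻¹) p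

/-- `log p`, via continuous functional calculus. -/
def plog (p : H →L[ℂ] H) : H →L[ℂ] H := cfc Real.log p

/-- The geodesic distance `d(p, q) = ‖log (p^{-1/2} q p^{-1/2})‖₂`. -/
def gdist (e : HilbertBasis ι ℂ H) (p q : H →L[ℂ] H) : ℝ :=
  hsNorm e (plog (pinvsqrt p * q * pinvsqrt p))

/-- The commutator `[A, B] = AB - BA`. -/
def brk (A B : H →L[ℂ] H) : H →L[ℂ] H := A * B - B * A

/-- The constant-speed geodesic `t ↦ p^{1/2} exp(t K) p^{1/2}`. -/
def geoCurve (p K : H →L[ℂ] H) (t : ℝ) : H →L[ℂ] H :=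
  psqrt p * NormedSpace.exp (t • K) * psqrt p

/-- The geodesic from `p` to `q`:
`t ↦ p^{1/2} exp(t log(p^{-1/2} q p^{-1/2})) p^{1/2}`. -/
def geodesic (p q : H →L[ℂ] H) (t : ℝ) : H →L[ℂ] H :=
  geoCurve p (plog (pinvsqrt p * q * pinvsqrt p)) t

/-- The image `exp E` of a set of operators under the exponential map. -/
def expSet (E : Set (H →L[ℂ] H)) : Set (H →L[ℂ] H) := NormedSpace.exp '' E

/-- The orthogonal complement of `E` inside `S₂(H)` for the Hilbert–Schmidt
inner product. -/
def hsPerp (e : HilbertBasis ι ℂ H) (E : Set (H →L[ℂ] H)) : Set (H →L[ℂ] H) :=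
  {Y | MemS2 e Y ∧ ∀ X ∈ E, hsInner e X Y = 0}

/-- `E` is closed in `S₂(H)` with respect to the Hilbert–Schmidt norm. -/
def IsHSClosed (e : HilbertBasis ι ℂ H) (E : Set (H →L[ℂ] H)) : Prop :=
  ∀ X : H →L[ℂ] H, MemS2 e X → (∀ ε > (0:ℝ), ∃ Y ∈ E, hsNorm e (X - Y) < ε) → X ∈ E


section Part1
open scoped InnerProductSpace
open MeasureTheory

structure HSData (B G : Type*) [CStarAlgebra B] [NormedAddCommGroup G]
    [InnerProductSpace ℝ G] where
  j : G →L[ℝ] B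
  L : B →L[ℝ] G →L[ℝ] G
  R : B →L[ℝ] G →L[ℝ] G
  inj : Function.Injective j
  norm_j : ∀ v, ‖j v‖ ≤ ‖v‖
  j_L : ∀ a v, j (L a v) = a * j v
  j_R : ∀ a v, j (R a v) = j v * a
  norm_L : ∀ a, ‖L a‖ ≤ ‖a‖
  norm_R : ∀ a, ‖R a‖ ≤ ‖a‖
  adj_L : ∀ a v w, ⟪L a v, w⟫_ℝ = ⟪v, L (star a) w⟫_ℝ
  adj_R : ∀ a v w, ⟪R a v, w⟫_ℝ = ⟪v, R (star a) w⟫_ℝ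

namespace HSData

section banach
variable {B : Type*} [CStarAlgebra B]

local notation "ex" => NormedSpace.exp

lemma norm_one_le' : ‖(1 : B)‖ ≤ 1 := by
  rcases subsingleton_or_nontrivial B with h | h
  · rw [Subsingleton.elim (1 : B) 0]; simp
  · rw [CStarRing.norm_one]

lemma norm_ex_le (a : B) : ‖ex a‖ ≤ Real.exp ‖a‖ := by
  have h1 := NormedSpace.exp_series_hasSum_exp' (𝕂 := ℝ) a
  have h2 := NormedSpace.exp_series_hasSum_exp' (𝕂 := ℝ) (‖a‖)
  rw [← h1.tsum_eq]
  rw [Real.exp_eq_exp_ℝ]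
  refine tsum_of_norm_bounded h2 ?_
  intro n
  rw [norm_smul]
  simp only [norm_inv, Real.norm_natCast, smul_eq_mul]
  gcongr
  rcases Nat.eq_zero_or_pos n with h | h
  · subst h; simpa using norm_one_le'
  · exact norm_pow_le' a h

lemma norm_ex_le_of {a : B} {r : ℝ} (h : ‖a‖ ≤ r) : ‖ex a‖ ≤ Real.exp r :=
  (norm_ex_le a).trans (Real.exp_le_exp.2 h)

lemma ex_add {a b : B} (h : Commute a b) : ex (a + b) = ex a * ex b := by
  let _ : NormedAlgebra ℚ B := NormedAlgebra.restrictScalars ℚ ℝ B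
  exact NormedSpace.exp_add_of_commute h

lemma ex_zero : ex (0 : B) = 1 := NormedSpace.exp_zero

lemma continuous_ex : Continuous (ex : B → B) := by
  let _ : NormedAlgebra ℚ B := NormedAlgebra.restrictScalars ℚ ℝ B
  exact NormedSpace.exp_continuous

lemma ex_neg_mul (a : B) : ex (-a) * ex a = 1 := by
  rw [← ex_add (Commute.neg_left (Commute.refl a))]; simp

lemma ex_mul_neg (a : B) : ex a * ex (-a) = 1 := by
  rw [← ex_add (Commute.neg_right (Commute.refl a))]; simp

lemma ex_smul_mul (s t : ℝ) (a : B) : ex (s • a) * ex (t • a) = ex ((s + t) • a) := by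
  rw [add_smul, ex_add]
  exact ((Commute.refl a).smul_left s).smul_right t

lemma star_ex {a : B} (ha : star a = a) : star (ex a) = ex a := by
  rw [NormedSpace.star_exp, ha]

lemma isUnit_ex (a : B) : IsUnit (ex a) :=
  ⟨⟨ex a, ex (-a), ex_mul_neg a, ex_neg_mul a⟩, rfl⟩

lemma hasDerivAt_T (a b : B) (t : ℝ) :
    HasDerivAt (fun t : ℝ => ex ((-t) • a) * ex (t • b))
      (ex ((-t) • a) * (b - a) * ex (t • b)) t := by
  have h1 := hasDerivAt_exp_smul_const (𝕂 := ℝ) (-a) t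
  have h2 := hasDerivAt_exp_smul_const' (𝕂 := ℝ) b t
  have h3 := h1.mul h2
  have e : ∀ t : ℝ, t • (-a) = (-t) • a := by intro t; simp
  simp only [e] at h3
  refine h3.congr_deriv ?_
  noncomm_ring

lemma ex_conj (u v a : B) (huv : u * v = 1) (hvu : v * u = 1) : ex (u * a * v) = u * ex a * v := by
  let _ : NormedAlgebra ℚ B := NormedAlgebra.restrictScalars ℚ ℝ B
  exact NormedSpace.exp_units_conj (⟨u, v, huv, hvu⟩ : Bˣ) a

lemma ex_inj {a b : B} (ha : star a = a) (hb : star b = b) (h : ex a = ex b) : a = b := by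
  rw [← CFC.log_exp a ha, h, CFC.log_exp b hb]

end banach
end HSData
end Part1

section Part2
open scoped InnerProductSpace
open MeasureTheory
namespace HSData
local notation "ex" => NormedSpace.exp

section core
variable {B G : Type*} [CStarAlgebra B] [NormedAddCommGroup G]
    [InnerProductSpace ℝ G] (D : HSData B G)

lemma L_mul (a b : B) (v : G) : D.L (a * b) v = D.L a (D.L b v) := by
  apply D.inj; simp [D.j_L, mul_assoc]
lemma R_mul (a b : B) (v : G) : D.R (a * b) v = D.R b (D.R a v) := by
  apply D.inj; simp [D.j_R, mul_assoc]
lemma L_one (v : G) : D.L 1 v = v := by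
  apply D.inj; simp [D.j_L]
lemma R_one (v : G) : D.R 1 v = v := by
  apply D.inj; simp [D.j_R]
lemma LR (a b : B) (v : G) : D.L a (D.R b v) = D.R b (D.L a v) := by
  apply D.inj; simp [D.j_L, D.j_R, mul_assoc]
lemma norm_L' (a : B) (v : G) : ‖D.L a v‖ ≤ ‖a‖ * ‖v‖ :=
  (D.L a).le_of_opNorm_le (D.norm_L a) v
lemma norm_R' (a : B) (v : G) : ‖D.R a v‖ ≤ ‖a‖ * ‖v‖ :=
  (D.R a).le_of_opNorm_le (D.norm_R a) v

/-- `T a b x v = e^{-xa} v e^{xb}`. -/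
def T (a b : B) (x : ℝ) : G →L[ℝ] G := (D.L (ex ((-x) • a))).comp (D.R (ex (x • b)))

lemma j_T (a b : B) (x : ℝ) (v : G) :
    D.j (D.T a b x v) = ex ((-x) • a) * D.j v * ex (x • b) := by
  simp [T, D.j_L, D.j_R, mul_assoc]

lemma T_add (a b : B) (x y : ℝ) (v : G) : D.T a b x (D.T a b y v) = D.T a b (x + y) v := by
  apply D.inj
  simp only [j_T]
  have h1 := ex_smul_mul (-x) (-y) a
  have h2 := ex_smul_mul y x b
  rw [show -(x + y) = -x + -y by ring, ← h1, add_comm x y, ← h2]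
  noncomm_ring

lemma T_zero (a b : B) (v : G) : D.T a b 0 v = v := by
  apply D.inj; simp [j_T]

lemma T_adj {a b : B} (ha : star a = a) (hb : star b = b) (x : ℝ) (v w : G) :
    ⟪D.T a b x v, w⟫_ℝ = ⟪v, D.T a b x w⟫_ℝ := by
  have h1 : star (ex ((-x) • a)) = ex ((-x) • a) := star_ex (by simp [ha])
  have h2 : star (ex (x • b)) = ex (x • b) := star_ex (by simp [hb])
  simp only [T, ContinuousLinearMap.comp_apply]
  rw [D.adj_L, D.adj_R, h1, h2, LR]

lemma norm_T (a b : B) {x r : ℝ} (h : |x| ≤ r) :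
    ‖D.T a b x‖ ≤ Real.exp (r * (‖a‖ + ‖b‖)) := by
  refine (ContinuousLinearMap.opNorm_comp_le _ _).trans ?_
  rw [mul_add, Real.exp_add]
  have h0 : 0 ≤ r := (abs_nonneg x).trans h
  refine mul_le_mul ((D.norm_L _).trans (norm_ex_le_of ?_))
    ((D.norm_R _).trans (norm_ex_le_of ?_)) (norm_nonneg _) (Real.exp_pos _).le
  · rw [norm_smul, norm_neg, Real.norm_eq_abs]; gcongr
  · rw [norm_smul, Real.norm_eq_abs]; gcongr

lemma continuous_T (a b : B) : Continuous (D.T a b) := by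
  have h1 : Continuous fun x : ℝ => ex ((-x) • a) := continuous_ex.comp (by fun_prop)
  have h2 : Continuous fun x : ℝ => ex (x • b) := continuous_ex.comp (by fun_prop)
  unfold T
  exact (D.L.continuous.comp h1).clm_comp (D.R.continuous.comp h2)

lemma T_pos {a b : B} (ha : star a = a) (hb : star b = b) (x : ℝ) (v : G) :
    2 * ‖v‖ ^ 2 ≤ ⟪v, D.T a b x v⟫_ℝ + ⟪v, D.T a b (-x) v⟫_ℝ := by
  have h1 : ∀ y, ⟪v, D.T a b y v⟫_ℝ = ‖D.T a b (y / 2) v‖ ^ 2 := by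
    intro y
    rw [← real_inner_self_eq_norm_sq, D.T_adj ha hb, T_add]
    congr 3; ring
  have h2 : ⟪D.T a b (x / 2) v, D.T a b (-x / 2) v⟫_ℝ = ‖v‖ ^ 2 := by
    rw [D.T_adj ha hb, T_add, show x / 2 + -x / 2 = 0 by ring, T_zero, real_inner_self_eq_norm_sq]
  rw [h1, h1]
  have h3 := norm_sub_sq_real (D.T a b (x / 2) v) (D.T a b (-x / 2) v)
  rw [h2] at h3
  nlinarith [sq_nonneg ‖D.T a b (x / 2) v - D.T a b (-x / 2) v‖]

/-- `S a b = ∫_{-1/2}^{1/2} T a b x dx`. -/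
def S (a b : B) : G →L[ℝ] G := ∫ x in (-(1/2) : ℝ)..(1/2), D.T a b x

lemma T_ii (a b : B) (s t : ℝ) : IntervalIntegrable (D.T a b) volume s t :=
  (D.continuous_T a b).intervalIntegrable _ _

variable [CompleteSpace G]

lemma S_apply (a b : B) (v : G) : D.S a b v = ∫ x in (-(1/2) : ℝ)..(1/2), D.T a b x v := by
  unfold S
  exact ((ContinuousLinearMap.apply ℝ G v).intervalIntegral_comp_comm (D.T_ii a b _ _)).symm

lemma j_S (X Y : G) : D.j (D.S (D.j X) (D.j Y) (Y - X)) =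
    ex ((-(1/2) : ℝ) • D.j X) * ex ((1/2 : ℝ) • D.j Y) -
    ex ((1/2 : ℝ) • D.j X) * ex ((-(1/2) : ℝ) • D.j Y) := by
  have hc : Continuous fun x => D.T (D.j X) (D.j Y) x (Y - X) :=
    (D.continuous_T _ _).clm_apply continuous_const
  rw [S_apply, ← ContinuousLinearMap.intervalIntegral_comp_comm _ (hc.intervalIntegrable _ _)]
  have hj : ∀ x, D.j (D.T (D.j X) (D.j Y) x (Y - X)) =
      ex ((-x) • D.j X) * (D.j Y - D.j X) * ex (x • D.j Y) := by
    intro x; rw [j_T, map_sub]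
  have := intervalIntegral.integral_eq_sub_of_hasDerivAt (a := (-(1/2) : ℝ)) (b := 1/2)
    (fun t _ => hasDerivAt_T (D.j X) (D.j Y) t)
    (by
      have h := ((D.j.continuous.comp hc).intervalIntegrable (μ := volume) (-(1/2) : ℝ) (1/2))
      simp only [Function.comp_def, hj] at h
      exact h)
  simp only [hj]
  rw [this]; simp

lemma S_pos {a b : B} (ha : star a = a) (hb : star b = b) (v : G) :
    ‖v‖ ^ 2 ≤ ⟪v, D.S a b v⟫_ℝ := by
  have hc : Continuous fun x => D.T a b x v := (D.continuous_T _ _).clm_apply continuous_const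
  have hf : Continuous fun x => ⟪v, D.T a b x v⟫_ℝ := continuous_const.inner hc
  have e1 : ⟪v, D.S a b v⟫_ℝ = ∫ x in (-(1/2) : ℝ)..(1/2), ⟪v, D.T a b x v⟫_ℝ := by
    rw [S_apply]
    exact ((innerSL ℝ v).intervalIntegral_comp_comm (hc.intervalIntegrable _ _)).symm
  have e2 : (∫ x in (-(1/2) : ℝ)..(1/2), ⟪v, D.T a b (-x) v⟫_ℝ) = ⟪v, D.S a b v⟫_ℝ := by
    rw [e1, intervalIntegral.integral_comp_neg (fun x => ⟪v, D.T a b x v⟫_ℝ)]; simp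
  have e3 : (∫ x in (-(1/2) : ℝ)..(1/2), (2 * ‖v‖ ^ 2)) ≤
      ∫ x in (-(1/2) : ℝ)..(1/2), (⟪v, D.T a b x v⟫_ℝ + ⟪v, D.T a b (-x) v⟫_ℝ) := by
    refine intervalIntegral.integral_mono_on (by norm_num) (by simp)
      ((hf.add (hf.comp continuous_neg)).intervalIntegrable _ _) ?_
    intro x _; exact D.T_pos ha hb x v
  have hf' : Continuous fun x => ⟪v, D.T a b (-x) v⟫_ℝ := hf.comp continuous_neg
  rw [intervalIntegral.integral_add (hf.intervalIntegrable _ _)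
    (hf'.intervalIntegrable _ _), e2, ← e1] at e3
  norm_num at e3
  linarith

lemma le_norm_S {a b : B} (ha : star a = a) (hb : star b = b) (v : G) :
    ‖v‖ ≤ ‖D.S a b v‖ := by
  have h1 := D.S_pos ha hb v
  have h2 := real_inner_le_norm v (D.S a b v)
  rcases (norm_nonneg v).eq_or_lt with h | h
  · rw [← h]; positivity
  · nlinarith

lemma norm_S (a b : B) : ‖D.S a b‖ ≤ Real.exp ((1/2) * (‖a‖ + ‖b‖)) := by
  have := intervalIntegral.norm_integral_le_of_norm_le_const (a := (-(1/2) : ℝ)) (b := 1/2)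
    (f := D.T a b) (C := Real.exp ((1/2) * (‖a‖ + ‖b‖))) (by
      intro x hx
      rw [Set.uIoc_of_le (by norm_num)] at hx
      exact D.norm_T a b (abs_le.2 ⟨hx.1.le, hx.2⟩))
  norm_num at this
  simpa [S] using this

/-- Hilbert–Schmidt Lipschitz bound for `exp`. -/
lemma ex_sub (X Y : G) : ∃ w : G, D.j w = ex (D.j Y) - ex (D.j X) ∧
    ‖w‖ ≤ Real.exp (‖X‖ + ‖Y‖) * ‖Y - X‖ := by
  refine ⟨D.L (ex ((1/2 : ℝ) • D.j X)) (D.R (ex ((1/2 : ℝ) • D.j Y))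
    (D.S (D.j X) (D.j Y) (Y - X))), ?_, ?_⟩
  · rw [D.j_L, D.j_R, j_S, sub_mul, mul_sub]
    have h1 : ∀ a : B, ex ((1/2 : ℝ) • a) * ex ((-(1/2) : ℝ) • a) = 1 := by
      intro a; rw [ex_smul_mul]; simp
    have h2 : ∀ a : B, ex ((-(1/2) : ℝ) • a) * ex ((1/2 : ℝ) • a) = 1 := by
      intro a; rw [ex_smul_mul]; simp
    have h3 : ∀ a : B, ex ((1/2 : ℝ) • a) * ex ((1/2 : ℝ) • a) = ex a := by
      intro a; rw [ex_smul_mul]; norm_num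
    rw [mul_assoc (ex ((1/2 : ℝ) • D.j X)) (ex ((-(1/2) : ℝ) • D.j Y)), h2, mul_one, h3,
      mul_assoc (ex ((-(1/2) : ℝ) • D.j X)), h3, ← mul_assoc, h1, one_mul]
  · have hX := D.norm_j X
    have hY := D.norm_j Y
    have h1 : ‖ex ((1/2 : ℝ) • D.j X)‖ ≤ Real.exp ((1/2) * ‖X‖) := by
      apply norm_ex_le_of; rw [norm_smul]; norm_num; linarith
    have h2 : ‖ex ((1/2 : ℝ) • D.j Y)‖ ≤ Real.exp ((1/2) * ‖Y‖) := by
      apply norm_ex_le_of; rw [norm_smul]; norm_num; linarith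
    have h3 : ‖D.S (D.j X) (D.j Y)‖ ≤ Real.exp ((1/2) * (‖X‖ + ‖Y‖)) :=
      (D.norm_S _ _).trans (Real.exp_le_exp.2 (by linarith))
    calc _ ≤ Real.exp ((1/2) * ‖X‖) * (Real.exp ((1/2) * ‖Y‖) *
          (Real.exp ((1/2) * (‖X‖ + ‖Y‖)) * ‖Y - X‖)) := by
          refine (D.norm_L' _ _).trans (mul_le_mul h1 ?_ (norm_nonneg _) (Real.exp_pos _).le)
          refine (D.norm_R' _ _).trans (mul_le_mul h2 ?_ (norm_nonneg _) (Real.exp_pos _).le)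
          exact ContinuousLinearMap.le_of_opNorm_le _ h3 _
      _ = _ := by
          rw [← mul_assoc, ← mul_assoc, ← Real.exp_add, ← Real.exp_add]; ring_nf

lemma norm_ex_sub (X Y : G) : ‖ex (D.j Y) - ex (D.j X)‖ ≤ Real.exp (‖X‖ + ‖Y‖) * ‖Y - X‖ := by
  obtain ⟨w, h1, h2⟩ := D.ex_sub X Y
  rw [← h1]; exact (D.norm_j w).trans h2

lemma ex_sub_one (X : G) : ∃ w : G, D.j w = ex (D.j X) - 1 ∧ ‖w‖ ≤ Real.exp ‖X‖ * ‖X‖ := by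
  simpa [ex_zero] using D.ex_sub 0 X

lemma norm_S_sub (X Y : G) : ‖D.S (D.j X) (D.j Y) - D.S (D.j X) (D.j X)‖ ≤
    Real.exp (2 * ‖X‖ + ‖Y‖) * ‖Y - X‖ := by
  have := intervalIntegral.norm_integral_le_of_norm_le_const (a := (-(1/2) : ℝ)) (b := 1/2)
    (f := fun x => D.T (D.j X) (D.j Y) x - D.T (D.j X) (D.j X) x)
    (C := Real.exp (2 * ‖X‖ + ‖Y‖) * ‖Y - X‖) (by
      intro x hx
      rw [Set.uIoc_of_le (by norm_num)] at hx
      have hx : |x| ≤ 1/2 := abs_le.2 ⟨hx.1.le, hx.2⟩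
      have hx1 : |x| ≤ 1 := by linarith
      have e : D.T (D.j X) (D.j Y) x - D.T (D.j X) (D.j X) x = 
        (D.L (ex ((-x) • D.j X))).comp (D.R (ex (x • D.j Y) - ex (x • D.j X))) := by
        ext v; simp [T]
      rw [e]
      have h1 : ‖ex ((-x) • D.j X)‖ ≤ Real.exp ‖X‖ := by
        apply norm_ex_le_of
        rw [norm_smul, norm_neg, Real.norm_eq_abs]
        have := D.norm_j X
        nlinarith [norm_nonneg X, norm_nonneg (D.j X), abs_nonneg x]
      have h2 : ‖ex (x • D.j Y) - ex (x • D.j X)‖ ≤ Real.exp (‖X‖ + ‖Y‖) * ‖Y - X‖ := by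
        have := D.norm_ex_sub (x • X) (x • Y)
        rw [map_smul, map_smul, ← smul_sub, norm_smul, norm_smul, norm_smul,
          Real.norm_eq_abs] at this
        refine this.trans ?_
        gcongr
        · exact mul_le_of_le_one_left (norm_nonneg _) hx1
        · exact mul_le_of_le_one_left (norm_nonneg _) hx1
        · exact mul_le_of_le_one_left (norm_nonneg _) hx1
      refine (ContinuousLinearMap.opNorm_comp_le _ _).trans ?_
      calc _ ≤ Real.exp ‖X‖ * (Real.exp (‖X‖ + ‖Y‖) * ‖Y - X‖) :=
            mul_le_mul ((D.norm_L _).trans h1) ((D.norm_R _).trans h2) (norm_nonneg _)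
              (Real.exp_pos _).le
        _ = _ := by rw [← mul_assoc, ← Real.exp_add]; ring_nf)
  rw [intervalIntegral.integral_sub (D.T_ii _ _ _ _) (D.T_ii _ _ _ _)] at this
  norm_num at this
  simpa [S] using this

end core
end HSData
end Part2

section Part3
open scoped InnerProductSpace
open MeasureTheory
namespace HSData
local notation "ex" => NormedSpace.exp

section pos
variable {B G : Type*} [CStarAlgebra B] [NormedAddCommGroup G]
    [InnerProductSpace ℝ G] (D : HSData B G)

def SA (X : G) : Prop := star (D.j X) = D.j X

variable {D} in
lemma SA.smul {X : G} (h : D.SA X) (t : ℝ) : D.SA (t • X) := by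
  unfold SA at *; simp [h]
variable {D} in
lemma SA.neg {X : G} (h : D.SA X) : D.SA (-X) := by
  unfold SA at *; simp [h]
variable {D} in
lemma SA.add {X Y : G} (h : D.SA X) (h' : D.SA Y) : D.SA (X + Y) := by
  unfold SA at *; simp [h, h']
lemma SA_zero : D.SA 0 := by simp [SA]

def PP (p : B) : Prop := ∃ X, D.SA X ∧ p = ex (D.j X)

lemma isStrictlyPositive_mul_star [PartialOrder B] [StarOrderedRing B] {g h : B} (hg : g * h = 1)
    (hh : h * g = 1) : IsStrictlyPositive (g * star g) :=
  ⟨mul_star_self_nonneg g, by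
    have : IsUnit g := ⟨⟨g, h, hg, hh⟩, rfl⟩
    exact this.mul this.star⟩

lemma dslope_log_le {x : ℝ} (hx : 1/2 ≤ x) : ‖dslope Real.log 1 x‖ ≤ 2 := by
  rcases eq_or_ne x 1 with h | h
  · subst h; simp
  · have h0 : 0 < x := by linarith
    have h1 : ‖Real.log x‖ ≤ 2 * ‖x - 1‖ := by
      have a1 := Real.log_le_sub_one_of_pos h0
      have a2 := Real.log_le_sub_one_of_pos (inv_pos.2 h0)
      rw [Real.log_inv] at a2
      have a3 : x⁻¹ - 1 = (1 - x) * x⁻¹ := by field_simp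
      have a4 : x⁻¹ ≤ 2 := by
        rw [inv_le_comm₀ h0 (by norm_num)]; linarith
      have a5 : 0 < x⁻¹ := inv_pos.2 h0
      rw [Real.norm_eq_abs, Real.norm_eq_abs]
      rcases le_total x 1 with b | b
      · have : |x - 1| = 1 - x := by rw [abs_of_nonpos (by linarith)]; ring
        rw [this, abs_le]
        constructor <;> nlinarith
      · have : |x - 1| = x - 1 := abs_of_nonneg (by linarith)
        rw [this, abs_le]
        constructor <;> nlinarith
    have h2 := sub_smul_dslope Real.log 1 x
    rw [Real.log_one, sub_zero] at h2
    rw [← h2, norm_smul, mul_comm] at h1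
    have : 0 < ‖x - 1‖ := norm_pos_iff.2 (sub_ne_zero.2 h)
    exact le_of_mul_le_mul_right h1 this

lemma PP_of [PartialOrder B] [StarOrderedRing B] {p : B} (hp : IsStrictlyPositive p) {w : G}
    (hw : D.j w = p - 1) :
    ∃ X, D.SA X ∧ p = ex (D.j X) ∧ (‖w‖ ≤ 1/2 → ‖X‖ ≤ 2 * ‖w‖) := by
  have hsa : IsSelfAdjoint p := hp.1.isSelfAdjoint
  have hpos : ∀ x ∈ spectrum ℝ p, 0 < x := by grind
  have hcont : ContinuousOn (dslope Real.log 1) (spectrum ℝ p) := by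
    have : ContinuousOn (dslope Real.log 1) (Set.Ioi 0) := by
      rw [continuousOn_dslope (Ioi_mem_nhds one_pos)]
      exact ⟨Real.continuousOn_log.mono (fun x hx => ne_of_gt hx),
        Real.differentiableAt_log one_ne_zero⟩
    exact this.mono hpos
  have hj : D.j (D.L (cfc (dslope Real.log 1) p) w) = CFC.log p := by
    rw [D.j_L, hw]
    have e1 : p - 1 = cfc (fun x : ℝ => x - 1) p := by
      rw [cfc_sub (fun x : ℝ => x) (fun _ => 1) p, cfc_id' ℝ p, cfc_const_one ℝ p]
    rw [e1, ← cfc_mul _ _ p hcont, CFC.log]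
    refine cfc_congr ?_
    intro x hx
    have := sub_smul_dslope Real.log 1 x
    simp only [smul_eq_mul, Real.log_one, sub_zero] at this
    simp only
    rw [← this, mul_comm]
  refine ⟨D.L (cfc (dslope Real.log 1) p) w, ?_, ?_, ?_⟩
  · unfold SA; rw [hj]; exact IsSelfAdjoint.log
  · rw [hj, CFC.exp_log p hp]
  · intro hn
    refine (D.norm_L' _ _).trans ?_
    gcongr
    apply norm_cfc_le (by norm_num)
    intro x hx
    apply dslope_log_le
    have h1 : ‖p - 1‖ ≤ 1/2 := by rw [← hw]; exact (D.norm_j w).trans hn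
    have h2 : x - 1 ∈ spectrum ℝ (p - 1) := by
      have := (spectrum.sub_singleton_eq p (1:ℝ))
      rw [map_one] at this
      rw [← this]
      exact Set.sub_mem_sub hx rfl
    have h3 := spectrum.norm_le_norm_mul_of_mem h2
    rw [Real.norm_eq_abs] at h3
    have h4 : ‖p - 1‖ * ‖(1:B)‖ ≤ 1/2 := by
      nlinarith [norm_nonneg (p - 1), norm_nonneg (1:B), norm_one_le' (B := B)]
    have := abs_le.1 (h3.trans h4)
    linarith [this.1]

lemma half_sq (a : B) : ex ((1/2 : ℝ) • a) * ex ((1/2 : ℝ) • a) = ex a := by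
  rw [ex_smul_mul]; norm_num

variable {D} in
lemma PP.sp [PartialOrder B] [StarOrderedRing B] {p : B} (hp : D.PP p) : IsStrictlyPositive p := by
  obtain ⟨X, h, rfl⟩ := hp
  have h1 : star (ex ((1/2 : ℝ) • D.j X)) = ex ((1/2 : ℝ) • D.j X) := by
    apply star_ex; rw [star_smul, h]; simp
  have := isStrictlyPositive_mul_star (ex_mul_neg ((1/2 : ℝ) • D.j X)) (ex_neg_mul _)
  rwa [h1, half_sq] at this

variable [CompleteSpace G]
variable {D} in
lemma PP.sub_one {p : B} (hp : D.PP p) : ∃ w, D.j w = p - 1 := by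
  obtain ⟨X, h, rfl⟩ := hp
  obtain ⟨w, hw, _⟩ := D.ex_sub_one X
  exact ⟨w, hw⟩

variable {D} in
lemma PP.sub {p q : B} (hp : D.PP p) (hq : D.PP q) : ∃ w, D.j w = p - q := by
  obtain ⟨w, hw⟩ := hp.sub_one
  obtain ⟨w', hw'⟩ := hq.sub_one
  exact ⟨w - w', by rw [map_sub, hw, hw']; abel⟩

lemma conj_sp [PartialOrder B] [StarOrderedRing B] {g h q : B} (hg : g * h = 1)
    (hh : h * g = 1) (hq : D.PP q) : IsStrictlyPositive (g * q * star g) := by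
  obtain ⟨X, hX, rfl⟩ := hq
  have h1 : star (ex ((1/2 : ℝ) • D.j X)) = ex ((1/2 : ℝ) • D.j X) := by
    apply star_ex; rw [star_smul, hX]; simp
  have := isStrictlyPositive_mul_star (g := g * ex ((1/2 : ℝ) • D.j X))
    (h := ex (-((1/2 : ℝ) • D.j X)) * h)
    (by rw [mul_assoc, ← mul_assoc (ex _), ex_mul_neg, one_mul, hg])
    (by rw [mul_assoc, ← mul_assoc h, hh, one_mul, ex_neg_mul])
  rwa [star_mul, h1, mul_assoc, ← mul_assoc (ex _), half_sq, ← mul_assoc] at this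

/-- conjugation with `g g* ∈ 1 + HS` -/
lemma PP_conj [PartialOrder B] [StarOrderedRing B] {g h q : B} (hg : g * h = 1)
    (hh : h * g = 1) {w : G} (hw : D.j w = g * star g - 1) (hq : D.PP q) :
    D.PP (g * q * star g) := by
  obtain ⟨v, hv⟩ := hq.sub_one
  have h2 : D.j (w + D.L g (D.R (star g) v)) = g * q * star g - 1 := by
    rw [map_add, hw, D.j_L, D.j_R, hv]; noncomm_ring
  obtain ⟨X, h3, h4, _⟩ := D.PP_of (D.conj_sp hg hh hq) h2
  exact ⟨X, h3, h4⟩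

/-- representation -/
lemma rep [PartialOrder B] [StarOrderedRing B] {g h q : B} (hg : g * h = 1)
    (hh : h * g = 1) {w : G} (hw : D.j w = q - g * star g) (hq : D.PP q) :
    ∃ W, D.SA W ∧ q = g * ex (D.j W) * star g ∧ 
      (‖h‖ * (‖star h‖ * ‖w‖) ≤ 1/2 → ‖W‖ ≤ 2 * (‖h‖ * (‖star h‖ * ‖w‖))) := by
  have hs1 : star g * star h = 1 := by rw [← star_mul, hh, star_one]
  have hs2 : star h * star g = 1 := by rw [← star_mul, hg, star_one]
  have h2 : D.j (D.L h (D.R (star h) w)) = h * q * star h - 1 := by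
    rw [D.j_L, D.j_R, hw]
    calc h * ((q - g * star g) * star h) = h * q * star h - (h * g) * (star g * star h) := by
          noncomm_ring
      _ = _ := by rw [hh, hs1, one_mul]
  obtain ⟨X, h3, h4, h5⟩ := D.PP_of (D.conj_sp hh hg hq) h2
  refine ⟨X, h3, ?_, ?_⟩
  · rw [← h4]
    calc q = (g * h) * q * (star h * star g) := by rw [hg, hs2, one_mul, mul_one]
      _ = _ := by noncomm_ring
  · have h6 : ‖D.L h (D.R (star h) w)‖ ≤ ‖h‖ * (‖star h‖ * ‖w‖) := by
      refine (D.norm_L' _ _).trans ?_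
      gcongr
      exact D.norm_R' _ _
    intro h7
    exact (h5 (h6.trans h7)).trans (by gcongr)

end pos
end HSData
end Part3

section Part4
open scoped InnerProductSpace
open MeasureTheory
namespace HSData
local notation "ex" => NormedSpace.exp

section emi
variable {B G : Type*} [CStarAlgebra B] [NormedAddCommGroup G]
    [InnerProductSpace ℝ G] (D : HSData B G) [CompleteSpace G]

lemma norm_le_one_of_mul_star {u : B} (h : u * star u = 1) : ‖u‖ ≤ 1 := by
  have h1 := CStarRing.norm_self_mul_star (x := u)
  rw [h] at h1
  have h2 := norm_one_le' (B := B)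
  nlinarith [norm_nonneg u]

lemma hm1 (a : B) : ex ((1/2 : ℝ) • a) * ex ((-(1/2) : ℝ) • a) = 1 := by
  rw [ex_smul_mul]; simp
lemma hm2 (a : B) : ex ((-(1/2) : ℝ) • a) * ex ((1/2 : ℝ) • a) = 1 := by
  rw [ex_smul_mul]; simp

lemma emi_weak {Z Z' W : G} (hZ : D.SA Z) (hZ' : D.SA Z') (hW : D.SA W) {g h : B}
    (hg : g * h = 1) (hh : h * g = 1) (e1 : ex (D.j Z) = g * star g)
    (e2 : ex (D.j Z') = g * ex (D.j W) * star g) :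
    ‖Z' - Z‖ ≤ Real.exp ‖W‖ * ‖W‖ := by
  have hs1 : star g * star h = 1 := by rw [← star_mul, hh, star_one]
  have hs2 : star h * star g = 1 := by rw [← star_mul, hg, star_one]
  obtain ⟨m, hm, hmn⟩ := D.ex_sub ((-(1/2) : ℝ) • W) ((1/2 : ℝ) • W)
  have hmn' : ‖m‖ ≤ Real.exp ‖W‖ * ‖W‖ := by
    convert hmn using 2
    · rw [norm_smul, norm_smul]; congr 1; norm_num; ring
    · rw [← sub_smul]; norm_num
  refine le_trans ?_ hmn'
  set zm := ex ((-(1/2) : ℝ) • D.j Z) with hzm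
  set zp := ex ((1/2 : ℝ) • D.j Z) with hzp
  set ym := ex ((-(1/2) : ℝ) • D.j Z') with hym
  set yp := ex ((1/2 : ℝ) • D.j Z') with hyp
  set wm := ex ((-(1/2) : ℝ) • D.j W) with hwm
  set wp := ex ((1/2 : ℝ) • D.j W) with hwp
  have a1 : zp * zm = 1 := hm1 _
  have a2 : zm * zp = 1 := hm2 _
  have a3 : yp * ym = 1 := hm1 _
  have a4 : ym * yp = 1 := hm2 _
  have a5 : wp * wm = 1 := hm1 _
  have a6 : wm * wp = 1 := hm2 _
  have b1 : zp * zp = ex (D.j Z) := half_sq _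
  have b2 : yp * yp = ex (D.j Z') := half_sq _
  have b3 : wp * wp = ex (D.j W) := half_sq _
  rw [← b1] at e1
  rw [← b2, ← b3] at e2
  have szm : star zm = zm := star_ex (by simp [show star (D.j Z) = D.j Z from hZ])
  have syp : star yp = yp := star_ex (by simp [show star (D.j Z') = D.j Z' from hZ'])
  have swm : star wm = wm := star_ex (by simp [show star (D.j W) = D.j W from hW])
  -- the unitaries
  set u := zm * g with hu
  set w := wm * h * yp with hw
  have u1 : ‖u‖ ≤ 1 := by
    apply norm_le_one_of_mul_star
    rw [hu, star_mul, szm]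
    calc zm * g * (star g * zm) = zm * (g * star g) * zm := by noncomm_ring
      _ = (zm * zp) * (zp * zm) := by rw [← e1]; noncomm_ring
      _ = 1 := by rw [a1, a2, one_mul]
  have w1 : ‖w‖ ≤ 1 := by
    apply norm_le_one_of_mul_star
    rw [hw, star_mul, star_mul, syp, swm]
    calc wm * h * yp * (yp * (star h * wm)) = wm * h * (yp * yp) * (star h * wm) := by noncomm_ring
      _ = (wm * ((h * g) * wp)) * (wp * ((star g * star h) * wm)) := by rw [e2]; noncomm_ring
      _ = 1 := by rw [hh, hs1, one_mul, one_mul, a5, a6, one_mul]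
  have key : D.S (D.j Z) (D.j Z') (Z' - Z) = D.L u (D.R w m) := by
    apply D.inj
    rw [D.j_S, D.j_L, D.j_R, hm, map_smul, map_smul]
    change zm * yp - zp * ym = u * ((wp - wm) * w)
    have c1 : zm * yp = u * wp * w := by
      calc zm * yp = zm * (g * ((wp * wm) * h)) * yp := by rw [a5, one_mul, hg, mul_one]
        _ = _ := by rw [hu, hw]; noncomm_ring
    have c2 : zp * ym = u * wm * w := by
      have d1 : g * (wm * wm) * h * (yp * yp) = zp * zp := by
        calc g * (wm * wm) * h * (yp * yp) = g * (wm * (wm * ((h * g) * wp)) * wp) * star g := by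
              rw [e2]; noncomm_ring
          _ = _ := by rw [hh, one_mul, a6, mul_one, a6, mul_one, e1]
      calc zp * ym = (zm * zp) * zp * ym := by rw [a2, one_mul]
        _ = zm * (zp * zp) * ym := by noncomm_ring
        _ = zm * (g * (wm * wm) * h) * yp * (yp * ym) := by rw [← d1]; noncomm_ring
        _ = u * wm * w := by rw [a3, hu, hw]; noncomm_ring
    rw [c1, c2]; noncomm_ring
  calc ‖Z' - Z‖ ≤ ‖D.S (D.j Z) (D.j Z') (Z' - Z)‖ := D.le_norm_S hZ hZ' _
    _ = ‖D.L u (D.R w m)‖ := by rw [key]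
    _ ≤ ‖u‖ * (‖w‖ * ‖m‖) := (D.norm_L' _ _).trans (by gcongr; exact D.norm_R' _ _)
    _ ≤ 1 * (1 * ‖m‖) := by gcongr
    _ = ‖m‖ := by ring

lemma star_ex_smul {W : G} (hW : D.SA W) (t : ℝ) :
    star (ex (t • D.j W)) = ex (t • D.j W) :=
  star_ex (by simp [show star (D.j W) = D.j W from hW])

variable [PartialOrder B] [StarOrderedRing B]

/-- exponential metric increasing property -/
lemma emi {X Y W : G} (hX : D.SA X) (hY : D.SA Y) (hW : D.SA W) {g h : B}
    (hg : g * h = 1) (hh : h * g = 1) (e1 : ex (D.j X) = g * star g)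
    (e2 : ex (D.j Y) = g * ex (D.j W) * star g) :
    ‖Y - X‖ ≤ ‖W‖ := by
  have main : ∀ n : ℕ, ‖Y - X‖ ≤ Real.exp (‖W‖ / (n + 1)) * ‖W‖ := by
    intro n
    obtain ⟨w0, hw0⟩ := (show D.PP (ex (D.j X)) from ⟨X, hX, rfl⟩).sub_one
    rw [e1] at hw0
    have hZ : ∀ k : ℕ, ∃ Z, D.SA Z ∧
        g * ex (((k : ℝ) / (n + 1)) • D.j W) * star g = ex (D.j Z) := by
      intro k
      exact D.PP_conj hg hh hw0 ⟨((k : ℝ) / (n + 1)) • W, hW.smul _, by rw [map_smul]⟩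
    choose Z hZ1 hZ2 using hZ
    have hn : (0 : ℝ) < n + 1 := by positivity
    have hstep : ∀ k, dist (Z k) (Z (k + 1)) ≤ Real.exp (‖W‖ / (n + 1)) * (‖W‖ / (n + 1)) := by
      intro k
      set s : ℝ := (k : ℝ) / (n + 1) / 2 with hs
      have := D.emi_weak (hZ1 k) (hZ1 (k + 1)) (hW.smul (1 / ((n : ℝ) + 1)))
        (g := g * ex (s • D.j W)) (h := ex ((-s) • D.j W) * h)
        (by rw [mul_assoc, ← mul_assoc (ex _), ex_smul_mul]; simp [hg])
        (by rw [mul_assoc, ← mul_assoc h, hh, one_mul, ex_smul_mul]; simp)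
        (by
          have : (k : ℝ) / (n + 1) = s + s := by rw [hs]; ring
          rw [← hZ2, star_mul, D.star_ex_smul hW, this, ← ex_smul_mul]
          noncomm_ring)
        (by
          have : ((k : ℝ) + 1) / (n + 1) = s + 1 / (n + 1) + s := by rw [hs]; ring
          rw [← hZ2, star_mul, D.star_ex_smul hW, map_smul]
          push_cast
          rw [this, ← ex_smul_mul, ← ex_smul_mul]
          noncomm_ring)
      rw [norm_smul] at this
      rw [dist_comm, dist_eq_norm]
      convert this using 2
      · congr 1; rw [Real.norm_of_nonneg (by positivity)]; ring
      · rw [Real.norm_of_nonneg (by positivity)]; ring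
    have h1 := dist_le_range_sum_dist Z (n + 1)
    have hz0 : Z 0 = X := by
      apply D.inj
      apply ex_inj (hZ1 0) hX
      rw [← hZ2, e1]; simp
    have hzn : Z (n + 1) = Y := by
      apply D.inj
      apply ex_inj (hZ1 _) hY
      rw [← hZ2, e2]
      push_cast
      rw [div_self hn.ne', one_smul]
    rw [hz0, hzn, dist_comm, dist_eq_norm] at h1
    refine h1.trans ((Finset.sum_le_sum (fun i _ => hstep i)).trans (le_of_eq ?_))
    rw [Finset.sum_const, Finset.card_range, nsmul_eq_mul]
    push_cast
    field_simp
  have hlim : Filter.Tendsto (fun n : ℕ => Real.exp (‖W‖ / (n + 1)) * ‖W‖) Filter.atTop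
      (nhds (Real.exp 0 * ‖W‖)) := by
    have h1 : Filter.Tendsto (fun n : ℕ => ‖W‖ / ((n : ℝ) + 1)) Filter.atTop (nhds 0) := by
      have := tendsto_one_div_add_atTop_nhds_zero_nat.const_mul ‖W‖
      simpa [div_eq_mul_inv] using this
    exact ((Real.continuous_exp.tendsto 0).comp h1).mul_const _
  have := ge_of_tendsto' hlim main
  simpa using this

end emi
end HSData
end Part4

section Part5
set_option linter.unusedSectionVars false
open scoped InnerProductSpace
open MeasureTheory
namespace HSData
local notation "ex" => NormedSpace.exp

section dist
variable {B G : Type*} [CStarAlgebra B] [NormedAddCommGroup G]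
    [InnerProductSpace ℝ G] (D : HSData B G) [CompleteSpace G]
 [PartialOrder B] [StarOrderedRing B]

def Rep (p q : B) (W : G) : Prop := ∃ g h : B, g * h = 1 ∧ h * g = 1 ∧ D.SA W ∧
  p = g * star g ∧ q = g * ex (D.j W) * star g

open Classical in
def dd (p q : B) : ℝ := if h : ∃ W, D.Rep p q W then ‖h.choose‖ else 0

lemma star_inv {g h : B} (hg : g * h = 1) : star h * star g = 1 := by
  rw [← star_mul, hg, star_one]

variable {D}
lemma Rep.norm_le {p q : B} {W W' : G} (r : D.Rep p q W) (r' : D.Rep p q W') : ‖W'‖ ≤ ‖W‖ := by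
  obtain ⟨g, h, hg, hh, sW, e1, e2⟩ := r
  obtain ⟨g', h', hg', hh', sW', e1', e2'⟩ := r'
  set u := h' * g with hu
  have su : star u = star g * star h' := by rw [hu, star_mul]
  have hs1 := star_inv hh'
  have hs2 := star_inv hg'
  have hs3 := star_inv hh
  have hs4 := star_inv hg
  have u1 : u * star u = 1 := by
    rw [su, hu]
    calc h' * g * (star g * star h') = h' * (g * star g) * star h' := by noncomm_ring
      _ = (h' * g') * (star g' * star h') := by rw [← e1, e1']; noncomm_ring
      _ = 1 := by rw [hh', hs1, one_mul]
  have u2 : star u * u = 1 := by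
    have : h * g' * u = 1 := by
      rw [hu]
      calc h * g' * (h' * g) = h * (g' * h') * g := by noncomm_ring
        _ = 1 := by rw [hg', mul_one, hh]
    have : star u = h * g' := by
      calc star u = (h * g' * u) * star u := by rw [this, one_mul]
        _ = _ := by rw [mul_assoc, u1, mul_one]
    rw [this]; assumption
  have key : W' = D.L u (D.R (star u) W) := by
    apply D.inj
    rw [D.j_L, D.j_R, ← mul_assoc]
    apply ex_inj sW'
    · rw [star_mul (u * D.j W), star_star, star_mul u, show star (D.j W) = D.j W from sW]
      exact (mul_assoc _ _ _).symm
    · rw [ex_conj _ _ _ u1 u2]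
      calc ex (D.j W') = (h' * g') * ex (D.j W') * (star g' * star h') := by
            rw [hh', hs1, one_mul, mul_one]
        _ = h' * (g' * ex (D.j W') * star g') * star h' := by noncomm_ring
        _ = h' * (g * ex (D.j W) * star g) * star h' := by rw [← e2', e2]
        _ = _ := by rw [su, hu]; noncomm_ring
  rw [key]
  have n1 : ‖u‖ ≤ 1 := norm_le_one_of_mul_star u1
  have n2 : ‖star u‖ ≤ 1 := by rwa [norm_star]
  calc _ ≤ ‖u‖ * (‖star u‖ * ‖W‖) := (D.norm_L' _ _).trans (by gcongr; exact D.norm_R' _ _)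
    _ ≤ 1 * (1 * ‖W‖) := by gcongr
    _ = ‖W‖ := by ring

lemma Rep.dd_eq {p q : B} {W : G} (r : D.Rep p q W) : D.dd p q = ‖W‖ := by
  have h : ∃ W, D.Rep p q W := ⟨W, r⟩
  rw [dd, dif_pos h]
  exact le_antisymm (r.norm_le h.choose_spec) (h.choose_spec.norm_le r)

lemma Rep.conj {p q : B} {W : G} (r : D.Rep p q W) {k l : B} (hk : k * l = 1) (hl : l * k = 1) :
    D.Rep (k * p * star k) (k * q * star k) W := by
  obtain ⟨g, h, hg, hh, sW, rfl, rfl⟩ := r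
  refine ⟨k * g, h * l, ?_, ?_, sW, ?_, ?_⟩
  · rw [mul_assoc, ← mul_assoc g, hg, one_mul, hk]
  · rw [mul_assoc, ← mul_assoc l, hl, one_mul, hh]
  · rw [star_mul]; noncomm_ring
  · rw [star_mul]; noncomm_ring

lemma Rep.symm {p q : B} {W : G} (r : D.Rep p q W) : D.Rep q p (-W) := by
  obtain ⟨g, h, hg, hh, sW, rfl, rfl⟩ := r
  refine ⟨g * ex ((1/2 : ℝ) • D.j W), ex ((-(1/2) : ℝ) • D.j W) * h, ?_, ?_, sW.neg, ?_, ?_⟩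
  · rw [mul_assoc, ← mul_assoc (ex _), hm1, one_mul, hg]
  · rw [mul_assoc, ← mul_assoc h, hh, one_mul, hm2]
  · rw [star_mul, D.star_ex_smul sW, ← half_sq]; noncomm_ring
  · rw [star_mul, D.star_ex_smul sW, map_neg]
    have : -D.j W = (-1 : ℝ) • D.j W := by simp
    rw [this]
    calc g * star g = g * ex ((1/2 + -1 + 1/2 : ℝ) • D.j W) * star g := by norm_num
      _ = _ := by rw [← ex_smul_mul, ← ex_smul_mul]; noncomm_ring

lemma dd_symm (p q : B) : D.dd p q = D.dd q p := by
  by_cases h : ∃ W, D.Rep p q W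
  · obtain ⟨W, r⟩ := h
    rw [r.dd_eq, r.symm.dd_eq, norm_neg]
  · have h' : ¬ ∃ W, D.Rep q p W := fun ⟨W, r⟩ => h ⟨_, r.symm⟩
    rw [dd, dd, dif_neg h, dif_neg h']

lemma PP.ex {X : G} (h : D.SA X) : D.PP (ex (D.j X)) := ⟨X, h, rfl⟩

/-- every `p ∈ P` has a square root in `P` -/
lemma PP.sqrt {p : B} (hp : D.PP p) : ∃ g h : B, g * h = 1 ∧ h * g = 1 ∧ star g = g ∧ star h = h ∧
    p = g * g ∧ D.PP g ∧ D.PP h := by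
  obtain ⟨X, h, rfl⟩ := hp
  refine ⟨_, _, hm1 (D.j X), hm2 (D.j X), D.star_ex_smul h _, D.star_ex_smul h _,
    (half_sq _).symm, ⟨(1/2 : ℝ) • X, h.smul _, by rw [map_smul]⟩,
    ⟨(-(1/2) : ℝ) • X, h.smul _, by rw [map_smul]⟩⟩

lemma exists_rep {p q : B} (hp : D.PP p) (hq : D.PP q) : ∃ W, D.Rep p q W := by
  obtain ⟨w, hw⟩ := hq.sub hp
  obtain ⟨g, h, hg, hh, sg, -, rfl, -, -⟩ := hp.sqrt
  obtain ⟨W, h1, h2, -⟩ := D.rep hg hh (w := w) (by rw [hw, sg]) hq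
  exact ⟨W, g, h, hg, hh, h1, by rw [sg], h2⟩

lemma dd_conj {p q : B} (hp : D.PP p) (hq : D.PP q) {k l : B} (hk : k * l = 1) (hl : l * k = 1) :
    D.dd (k * p * star k) (k * q * star k) = D.dd p q := by
  obtain ⟨W, r⟩ := exists_rep hp hq
  rw [r.dd_eq, (r.conj hk hl).dd_eq]

lemma dd_one {X : G} (h : D.SA X) : D.dd 1 (ex (D.j X)) = ‖X‖ :=
  Rep.dd_eq ⟨1, 1, by simp, by simp, h, by simp, by simp⟩

lemma dd_emi {X Y : G} (hX : D.SA X) (hY : D.SA Y) :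
    ‖Y - X‖ ≤ D.dd (ex (D.j X)) (ex (D.j Y)) := by
  obtain ⟨W, r⟩ := exists_rep (PP.ex hX) (PP.ex hY)
  rw [r.dd_eq]
  obtain ⟨g, h, hg, hh, sW, e1, e2⟩ := r
  exact D.emi hX hY sW hg hh e1 e2

/-- `P` is stable under conjugation by `g ∈ P` -/
lemma PP.conj {g q : B} (hg : D.PP g) (hq : D.PP q) : D.PP (g * q * g) := by
  obtain ⟨w, hw⟩ := hg.sub_one
  obtain ⟨X, h, rfl⟩ := hg
  have hs : star (NormedSpace.exp (D.j X)) = NormedSpace.exp (D.j X) := star_ex h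
  have := D.PP_conj (ex_mul_neg (D.j X)) (ex_neg_mul (D.j X))
    (w := w + D.R (NormedSpace.exp (D.j X)) w) (by
      rw [map_add, D.j_R, hw, hs]; noncomm_ring) hq
  rwa [hs] at this

lemma dd_nonneg (p q : B) : 0 ≤ D.dd p q := by
  unfold dd; split_ifs <;> positivity

lemma dd_triangle {x y z : B} (hx : D.PP x) (hy : D.PP y) (hz : D.PP z) :
    D.dd x z ≤ D.dd x y + D.dd y z := by
  obtain ⟨g, h, hg, hh, sg, sh, rfl, pg, ph⟩ := hx.sqrt
  obtain ⟨Y, sY, eY⟩ := ph.conj hy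
  obtain ⟨Z, sZ, eZ⟩ := ph.conj hz
  rw [← dd_conj hx hz hh hg, ← dd_conj hx hy hh hg, ← dd_conj hy hz hh hg, sh, eY, eZ]
  have : h * (g * g) * h = 1 := by
    calc h * (g * g) * h = (h * g) * (g * h) := by noncomm_ring
      _ = 1 := by rw [hg, hh, one_mul]
  rw [this, dd_one sY, dd_one sZ]
  have h1 := dd_emi sY sZ
  have h2 := norm_add_le Y (Z - Y)
  rw [add_sub_cancel] at h2
  linarith

/-- continuity of the distance for the HS norm -/
lemma dd_le {p q g h : B} (hg : g * h = 1) (hh : h * g = 1) (hp : p = g * star g) (hq : D.PP q)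
    {w : G} (hw : D.j w = q - p) (hs : ‖h‖ * ‖h‖ * ‖w‖ ≤ 1/2) :
    D.dd p q ≤ 2 * (‖h‖ * ‖h‖ * ‖w‖) := by
  obtain ⟨W, h1, h2, h3⟩ := D.rep hg hh (w := w) (by rw [hw, hp]) hq
  rw [norm_star, ← mul_assoc] at h3
  rw [Rep.dd_eq ⟨g, h, hg, hh, h1, hp, h2⟩]
  exact h3 hs

/-- semi-parallelogram law, centered form -/
lemma semipar {k l : B} (hk : k * l = 1) (hl : l * k = 1) {V W : G} (hV : D.SA V) (hW : D.SA W) :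
    D.dd (k * ex (D.j (-W)) * star k) (k * ex (D.j W) * star k) ^ 2 +
      4 * D.dd (k * star k) (k * ex (D.j V) * star k) ^ 2 ≤
      2 * D.dd (k * ex (D.j (-W)) * star k) (k * ex (D.j V) * star k) ^ 2 +
      2 * D.dd (k * ex (D.j W) * star k) (k * ex (D.j V) * star k) ^ 2 := by
  have h1 : D.dd (k * star k) (k * ex (D.j V) * star k) = ‖V‖ :=
    Rep.dd_eq ⟨k, l, hk, hl, hV, rfl, rfl⟩
  have hP1 := PP.ex hW
  have hP2 := PP.ex hV
  have hP3 := PP.ex hW.neg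
  rw [dd_conj hP3 hP1 hk hl, dd_conj hP3 hP2 hk hl, dd_conj hP1 hP2 hk hl, h1]
  have h2 := dd_emi hW.neg hV
  have h3 := dd_emi hW hV
  have h4 : D.dd (ex (D.j (-W))) (ex (D.j W)) = 2 * ‖W‖ := by
    have : D.dd (ex (D.j (-W))) (ex (D.j W)) = ‖(2:ℝ) • W‖ := by
      apply Rep.dd_eq
      refine ⟨ex ((-(1/2) : ℝ) • D.j W), ex ((1/2 : ℝ) • D.j W), hm2 _, hm1 _, hW.smul _, ?_, ?_⟩
      · rw [D.star_ex_smul hW, ex_smul_mul, map_neg]; norm_num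
      · rw [D.star_ex_smul hW, map_smul, ex_smul_mul, ex_smul_mul]; norm_num
    rw [this, norm_smul]; norm_num
  rw [h4]
  have h5 : ‖V - -W‖ ^ 2 ≤ D.dd (ex (D.j (-W))) (ex (D.j V)) ^ 2 := by gcongr
  have h6 : ‖V - W‖ ^ 2 ≤ D.dd (ex (D.j W)) (ex (D.j V)) ^ 2 := by gcongr
  have h7 := parallelogram_law_with_norm ℝ V W
  rw [sub_neg_eq_add] at h5
  nlinarith

end dist
end HSData
end Part5

section Part6
open scoped InnerProductSpace
open MeasureTheory
namespace HSData
local notation "ex" => NormedSpace.exp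

section inv
variable {B G : Type*} [CStarAlgebra B] [NormedAddCommGroup G]
    [InnerProductSpace ℝ G] (D : HSData B G) [CompleteSpace G]

/-- the derivation `ad` -/
def ad (a : B) : G →L[ℝ] G := D.R a - D.L a

lemma L_pow (a : B) (n : ℕ) : D.L (a ^ n) = D.L a ^ n := by
  induction n with
  | zero => ext v; simp [L_one]
  | succ n ih => ext v; rw [pow_succ, pow_succ, L_mul, ih]; rfl

lemma R_pow (a : B) (n : ℕ) : D.R (a ^ n) = D.R a ^ n := by
  induction n with
  | zero => ext v; simp [R_one]
  | succ n ih => ext v; rw [pow_succ', pow_succ, R_mul, ih]; rfl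

lemma L_ex (a : B) : D.L (ex a) = ex (D.L a) := by
  have h1 := NormedSpace.exp_series_hasSum_exp' (𝕂 := ℝ) a
  have h2 := NormedSpace.exp_series_hasSum_exp' (𝕂 := ℝ) (D.L a)
  have h3 := D.L.hasSum h1
  simp only [map_smul, L_pow] at h3
  exact h3.unique h2

lemma R_ex (a : B) : D.R (ex a) = ex (D.R a) := by
  have h1 := NormedSpace.exp_series_hasSum_exp' (𝕂 := ℝ) a
  have h2 := NormedSpace.exp_series_hasSum_exp' (𝕂 := ℝ) (D.R a)
  have h3 := D.R.hasSum h1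
  simp only [map_smul, R_pow] at h3
  exact h3.unique h2

lemma T_eq (a : B) (x : ℝ) : D.T a a x = ex (x • D.ad a) := by
  let _ : NormedAlgebra ℚ (G →L[ℝ] G) := NormedAlgebra.restrictScalars ℚ ℝ _
  have hc : Commute (D.L ((-x) • a)) (D.R (x • a)) := by
    ext v; exact D.LR _ _ _
  have : x • D.ad a = D.L ((-x) • a) + D.R (x • a) := by
    simp [ad, smul_sub]; abel
  rw [this, NormedSpace.exp_add_of_commute hc, ← L_ex, ← R_ex]
  rfl

variable {E : Submodule ℝ G} (hE : IsClosed (E : Set G))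

lemma T_sum_mem (hE : IsClosed (E : Set G)) {a : B} (had : ∀ v ∈ E, D.ad a (D.ad a v) ∈ E) (x : ℝ) {v : G} (hv : v ∈ E) :
    D.T a a x v + D.T a a (-x) v ∈ E := by
  have hp : ∀ m : ℕ, (D.ad a ^ (m + m)) v ∈ E := by
    intro m
    induction m with
    | zero => simpa
    | succ m ih =>
      have : m + 1 + (m + 1) = (m + m) + 1 + 1 := by ring
      rw [this, pow_succ', pow_succ']
      exact had _ ih
  have hs : ∀ y : ℝ, HasSum (fun n : ℕ => (n.factorial : ℝ)⁻¹ • (y ^ n • (D.ad a ^ n) v)) (D.T a a y v) := by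
    intro y
    rw [T_eq]
    have h1 := NormedSpace.exp_series_hasSum_exp' (𝕂 := ℝ) (y • D.ad a)
    have h2 := (ContinuousLinearMap.apply ℝ G v).hasSum h1
    simpa [smul_pow] using h2
  have h3 := (hs x).add (hs (-x))
  refine hE.mem_of_tendsto h3 (Filter.Eventually.of_forall fun s => E.sum_mem fun n _ => ?_)
  rcases Nat.even_or_odd n with h | h
  · rw [h.neg_pow]
    obtain ⟨m, rfl⟩ := h
    exact E.add_mem (E.smul_mem _ (E.smul_mem _ (hp m))) (E.smul_mem _ (E.smul_mem _ (hp m)))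
  · rw [h.neg_pow]; simp

lemma S_mem (hE : IsClosed (E : Set G)) {a : B} (had : ∀ v ∈ E, D.ad a (D.ad a v) ∈ E) {v : G} (hv : v ∈ E) :
    D.S a a v ∈ E := by
  have : (2 : ℝ) • D.S a a v ∈ E := by
    have hc : Continuous fun x => D.T a a x v := (D.continuous_T _ _).clm_apply continuous_const
    have hc' : Continuous fun x => D.T a a (-x) v := hc.comp continuous_neg
    have e : (2 : ℝ) • D.S a a v = ∫ x in (-(1/2) : ℝ)..(1/2), (D.T a a x v + D.T a a (-x) v) := by
      rw [intervalIntegral.integral_add (hc.intervalIntegrable _ _) (hc'.intervalIntegrable _ _),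
        intervalIntegral.integral_comp_neg (fun x => D.T a a x v), ← S_apply, neg_neg, ← S_apply, two_smul]
    rw [e]
    have : CompleteSpace E := hE.completeSpace_coe
    let f : ℝ → E := fun x => ⟨D.T a a x v + D.T a a (-x) v, D.T_sum_mem hE had x hv⟩
    have hf : Continuous f := (hc.add hc').subtype_mk _
    have := E.subtypeL.intervalIntegral_comp_comm (hf.intervalIntegrable (μ := volume) (-(1/2) : ℝ) (1/2))
    have e2 : ∀ x, E.subtypeL (f x) = D.T a a x v + D.T a a (-x) v := fun x => rfl
    simp only [e2] at this
    rw [this]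
    exact Submodule.coe_mem _
  simpa [smul_smul] using E.smul_mem (1/2 : ℝ) this

lemma S_surj (hE : IsClosed (E : Set G)) {a : B} (ha : star a = a)
    (had : ∀ v ∈ E, D.ad a (D.ad a v) ∈ E) {v : G} (hv : v ∈ E) :
    ∃ u ∈ E, D.S a a u = v := by
  have : CompleteSpace E := hE.completeSpace_coe
  let f : E →L[ℝ] E := ((D.S a a).comp E.subtypeL).codRestrict E (fun x => D.S_mem hE had x.2)
  have hu : IsUnit f := by
    refine ContinuousLinearMap.isUnit_of_forall_le_norm_inner_map f (c := 1) one_pos fun x => ?_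
    have h1 := D.S_pos ha ha (x : G)
    have h2 : ⟪f x, x⟫_ℝ = ⟪(x : G), D.S a a x⟫_ℝ := by rw [real_inner_comm]; rfl
    rw [h2]
    simp only [NNReal.coe_one, mul_one]
    exact h1.trans (le_abs_self _)
  obtain ⟨u, hu⟩ := (ContinuousLinearMap.isUnit_iff_bijective.1 hu).2 ⟨v, hv⟩
  exact ⟨u, u.2, congrArg Subtype.val hu⟩

lemma ex_sub2 (X Y : G) : ∃ w : G, D.j w = ex (D.j Y) - ex (D.j X) -
      ex ((1/2 : ℝ) • D.j X) * D.j (D.S (D.j X) (D.j X) (Y - X)) * ex ((1/2 : ℝ) • D.j X) ∧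
    ‖w‖ ≤ 2 * Real.exp (3 * ‖X‖ + 2 * ‖Y‖) * ‖Y - X‖ ^ 2 := by
  refine ⟨D.L (ex ((1/2 : ℝ) • D.j X)) (D.R (ex ((1/2 : ℝ) • D.j Y))
    ((D.S (D.j X) (D.j Y) - D.S (D.j X) (D.j X)) (Y - X))) +
    D.L (ex ((1/2 : ℝ) • D.j X)) (D.R (ex ((1/2 : ℝ) • D.j Y) - ex ((1/2 : ℝ) • D.j X))
    (D.S (D.j X) (D.j X) (Y - X))), ?_, ?_⟩
  · rw [map_add, D.j_L, D.j_R, D.j_L, D.j_R, ContinuousLinearMap.sub_apply, map_sub D.j (D.S _ _ _), j_S]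
    have e1 : ex (D.j Y) = (ex ((1/2 : ℝ) • D.j X) * ex ((-(1/2) : ℝ) • D.j X)) * (ex ((1/2 : ℝ) • D.j Y) * ex ((1/2 : ℝ) • D.j Y)) := by
      rw [hm1, half_sq, one_mul]
    have e2 : ex (D.j X) = (ex ((1/2 : ℝ) • D.j X) * ex ((1/2 : ℝ) • D.j X)) * (ex ((-(1/2) : ℝ) • D.j Y) * ex ((1/2 : ℝ) • D.j Y)) := by
      rw [hm2, half_sq, mul_one]
    rw [e1, e2]
    noncomm_ring
  · have hX := D.norm_j X
    have hY := D.norm_j Y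
    have h1 : ‖ex ((1/2 : ℝ) • D.j X)‖ ≤ Real.exp (‖X‖) := by
      apply norm_ex_le_of; rw [norm_smul]; norm_num; linarith [norm_nonneg X]
    have h2 : ‖ex ((1/2 : ℝ) • D.j Y)‖ ≤ Real.exp (‖Y‖) := by
      apply norm_ex_le_of; rw [norm_smul]; norm_num; linarith [norm_nonneg Y]
    have h3 : ‖D.S (D.j X) (D.j X)‖ ≤ Real.exp (‖X‖) :=
      (D.norm_S _ _).trans (Real.exp_le_exp.2 (by linarith))
    have h4 := D.norm_S_sub X Y
    have h5 : ‖ex ((1/2 : ℝ) • D.j Y) - ex ((1/2 : ℝ) • D.j X)‖ ≤ Real.exp (‖X‖ + ‖Y‖) * ‖Y - X‖ := by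
      have := D.norm_ex_sub ((1/2 : ℝ) • X) ((1/2 : ℝ) • Y)
      rw [map_smul, map_smul, ← smul_sub, norm_smul, norm_smul, norm_smul] at this
      refine this.trans ?_
      have hh : ‖(1/2 : ℝ)‖ ≤ 1 := by norm_num
      gcongr
      · exact mul_le_of_le_one_left (norm_nonneg _) hh
      · exact mul_le_of_le_one_left (norm_nonneg _) hh
      · exact mul_le_of_le_one_left (norm_nonneg _) hh
    calc _ ≤ Real.exp ‖X‖ * (Real.exp ‖Y‖ * (Real.exp (2 * ‖X‖ + ‖Y‖) * ‖Y - X‖ * ‖Y - X‖)) +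
         Real.exp ‖X‖ * (Real.exp (‖X‖ + ‖Y‖) * ‖Y - X‖ * (Real.exp ‖X‖ * ‖Y - X‖)) := by
          refine (norm_add_le _ _).trans (add_le_add ?_ ?_)
          · refine (D.norm_L' _ _).trans (mul_le_mul h1 ?_ (norm_nonneg _) (Real.exp_pos _).le)
            refine (D.norm_R' _ _).trans (mul_le_mul h2 ?_ (norm_nonneg _) (Real.exp_pos _).le)
            exact ContinuousLinearMap.le_of_opNorm_le _ h4 _
          · refine (D.norm_L' _ _).trans (mul_le_mul h1 ?_ (norm_nonneg _) (Real.exp_pos _).le)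
            refine (D.norm_R' _ _).trans (mul_le_mul h5 ?_ (norm_nonneg _) (by positivity))
            exact ContinuousLinearMap.le_of_opNorm_le _ h3 _
      _ = Real.exp (3 * ‖X‖ + 2 * ‖Y‖) * ‖Y - X‖ ^ 2 + Real.exp (3 * ‖X‖ + ‖Y‖) * ‖Y - X‖ ^ 2 := by
          rw [show 3 * ‖X‖ + 2 * ‖Y‖ = ‖X‖ + ‖Y‖ + (2 * ‖X‖ + ‖Y‖) by ring,
            show 3 * ‖X‖ + ‖Y‖ = ‖X‖ + (‖X‖ + ‖Y‖) + ‖X‖ by ring,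
            Real.exp_add (‖X‖ + ‖Y‖) (2 * ‖X‖ + ‖Y‖), Real.exp_add (‖X‖ + (‖X‖ + ‖Y‖)) ‖X‖,
            Real.exp_add ‖X‖ (‖X‖ + ‖Y‖), Real.exp_add ‖X‖ ‖Y‖]
          ring
      _ ≤ Real.exp (3 * ‖X‖ + 2 * ‖Y‖) * ‖Y - X‖ ^ 2 + Real.exp (3 * ‖X‖ + 2 * ‖Y‖) * ‖Y - X‖ ^ 2 := by
          gcongr
          linarith [norm_nonneg Y]
      _ = _ := by ring

lemma S_zero (v : G) : D.S 0 0 v = v := by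
  have : ∀ x, D.T 0 0 x v = v := by
    intro x; apply D.inj; simp [j_T, ex_zero]
  rw [S_apply]
  simp only [this]
  norm_num

lemma ex_sub_one2 (X : G) : ∃ w : G, D.j w = ex (D.j X) - 1 - D.j X ∧
    ‖w‖ ≤ 2 * Real.exp (2 * ‖X‖) * ‖X‖ ^ 2 := by
  simpa [ex_zero, S_zero] using D.ex_sub2 0 X

end inv
end HSData
end Part6

section Part7
set_option linter.unusedSectionVars false
open scoped InnerProductSpace
open MeasureTheory
namespace HSData
local notation "ex" => NormedSpace.exp

section euler
variable {B G : Type*} [CStarAlgebra B] [NormedAddCommGroup G]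
    [InnerProductSpace ℝ G] (D : HSData B G) [CompleteSpace G]
 [PartialOrder B] [StarOrderedRing B]

/-- closed Lie-triple-like subspaces -/
structure LT (E : Submodule ℝ G) : Prop where
  cl : IsClosed (E : Set G)
  sa : ∀ X ∈ E, D.SA X
  lt : ∀ X ∈ E, ∀ Y ∈ E, D.ad (D.j X) (D.ad (D.j X) Y) ∈ E

variable {D} {E : Submodule ℝ G}

lemma LT.dir (hE : D.LT E) {X Z : G} (hX : X ∈ E) (hZ : Z ∈ E) :
    ∃ U ∈ E, ex ((1/2 : ℝ) • D.j Z) * D.j (D.S (D.j Z) (D.j Z) U) * ex ((1/2 : ℝ) • D.j Z) =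
      D.j X * ex (D.j Z) + ex (D.j Z) * D.j X ∧ ‖U‖ ≤ 2 * Real.exp ‖Z‖ * ‖X‖ := by
  have h1 := D.T_sum_mem hE.cl (hE.lt Z hZ) (1/2) hX
  obtain ⟨U, hU, e⟩ := D.S_surj hE.cl (hE.sa Z hZ) (hE.lt Z hZ) h1
  refine ⟨U, hU, ?_, ?_⟩
  · rw [e, map_add, j_T, j_T, neg_neg]
    calc _ = (ex ((1/2 : ℝ) • D.j Z) * ex ((-(1/2) : ℝ) • D.j Z)) * D.j X *
          (ex ((1/2 : ℝ) • D.j Z) * ex ((1/2 : ℝ) • D.j Z)) +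
          (ex ((1/2 : ℝ) • D.j Z) * ex ((1/2 : ℝ) • D.j Z)) * D.j X *
          (ex ((-(1/2) : ℝ) • D.j Z) * ex ((1/2 : ℝ) • D.j Z)) := by noncomm_ring
      _ = _ := by rw [hm1, hm2, half_sq, one_mul, mul_one]
  · refine (D.le_norm_S (hE.sa Z hZ) (hE.sa Z hZ) U).trans ?_
    rw [e]
    have hj := D.norm_j Z
    have hT : ∀ x : ℝ, |x| ≤ 1/2 → ‖D.T (D.j Z) (D.j Z) x X‖ ≤ Real.exp ‖Z‖ * ‖X‖ := fun x hx =>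
      ContinuousLinearMap.le_of_opNorm_le _ ((D.norm_T _ _ hx).trans
        (Real.exp_le_exp.2 (by linarith))) _
    have ha := hT (1/2) (by norm_num [abs_of_pos])
    have hb := hT (-(1/2)) (by norm_num [abs_of_pos])
    refine (norm_add_le _ _).trans ?_
    linarith

lemma LT.step (hE : D.LT E) {X : G} (hX : X ∈ E) (R : ℝ) : ∃ K : ℝ, 0 ≤ K ∧ ∀ Z ∈ E, ‖Z‖ ≤ R →
    ∀ s : ℝ, 0 ≤ s → s ≤ 1 → K * s ^ 2 ≤ 1 → ∃ Z' ∈ E,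
      D.dd (ex (s • D.j X) * ex (D.j Z) * ex (s • D.j X)) (ex (D.j Z')) ≤ K * s ^ 2 := by
  set N := ‖X‖ with hN
  set M := 2 * Real.exp R * N with hM
  have hM0 : 0 ≤ M := by positivity
  have hN0 : 0 ≤ N := norm_nonneg _
  refine ⟨2 * (Real.exp (R + 2 * N) * (5 * Real.exp (R + 2 * N) * N ^ 2 + 2 * Real.exp (5 * R + 2 * M) * M ^ 2)), by positivity, ?_⟩
  intro Z hZ hZR s hs0 hs1 hK
  obtain ⟨U, hU, eU, nU⟩ := hE.dir hX hZ
  have nU : ‖U‖ ≤ M := nU.trans (by rw [hM]; gcongr)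
  refine ⟨Z + s • U, E.add_mem hZ (E.smul_mem _ hU), ?_⟩
  obtain ⟨w2, ew2, nw2⟩ := D.ex_sub2 Z (Z + s • U)
  obtain ⟨r, er, nr⟩ := D.ex_sub_one2 (s • X)
  obtain ⟨u, eu, nu⟩ := D.ex_sub_one (s • X)
  rw [add_sub_cancel_left, map_smul, map_smul, mul_smul_comm, smul_mul_assoc, eU] at ew2
  rw [map_smul] at er eu
  have nsX : ‖s • X‖ = s * N := by rw [norm_smul, Real.norm_of_nonneg hs0]
  have nsU : ‖s • U‖ = s * ‖U‖ := by rw [norm_smul, Real.norm_of_nonneg hs0]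
  rw [nsX] at nr nu
  rw [add_sub_cancel_left, nsU] at nw2
  have hsN : s * N ≤ N := mul_le_of_le_one_left hN0 hs1
  have hsU : s * ‖U‖ ≤ M := (mul_le_of_le_one_left (norm_nonneg _) hs1).trans nU
  have nw2 : ‖w2‖ ≤ 2 * Real.exp (5 * R + 2 * M) * M ^ 2 * s ^ 2 := by
    refine nw2.trans ?_
    have : ‖Z + s • U‖ ≤ R + M := (norm_add_le _ _).trans (by rw [nsU]; linarith)
    calc _ ≤ 2 * Real.exp (3 * R + 2 * (R + M)) * (s * M) ^ 2 := by gcongr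
      _ = _ := by ring_nf
  have nr : ‖r‖ ≤ 2 * Real.exp (2 * N) * N ^ 2 * s ^ 2 := by
    refine nr.trans ?_
    calc _ ≤ 2 * Real.exp (2 * N) * (s * N) ^ 2 := by gcongr
      _ = _ := by ring
  have nu : ‖u‖ ≤ Real.exp N * N * s := by
    refine nu.trans ?_
    calc _ ≤ Real.exp N * (s * N) := by gcongr
      _ = _ := by ring
  have nq : ‖ex (D.j Z)‖ ≤ Real.exp R := norm_ex_le_of ((D.norm_j Z).trans hZR)
  set q := ex (D.j Z) with hq
  set w := w2 - (D.R q r + D.L q r + D.L (D.j u) (D.L q u)) with hw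
  have ew : D.j w = ex (D.j (Z + s • U)) - ex (s • D.j X) * q * ex (s • D.j X) := by
    rw [hw]
    simp only [map_sub D.j, map_add D.j, D.j_L, D.j_R]
    simp only [ew2, er, eu]
    simp only [smul_add, ← smul_mul_assoc, ← mul_smul_comm s q]
    simp only [map_add, map_smul]
    noncomm_ring
  have nw : ‖w‖ ≤ (5 * Real.exp (R + 2 * N) * N ^ 2 + 2 * Real.exp (5 * R + 2 * M) * M ^ 2) * s ^ 2 := by
    have b1 : ‖D.R q r‖ ≤ Real.exp R * (2 * Real.exp (2 * N) * N ^ 2 * s ^ 2) :=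
      (D.norm_R' _ _).trans (by gcongr)
    have b2 : ‖D.L q r‖ ≤ Real.exp R * (2 * Real.exp (2 * N) * N ^ 2 * s ^ 2) :=
      (D.norm_L' _ _).trans (by gcongr)
    have b3 : ‖D.L (D.j u) (D.L q u)‖ ≤ (Real.exp N * N * s) * (Real.exp R * (Real.exp N * N * s)) := by
      refine (D.norm_L' _ _).trans (mul_le_mul ((D.norm_j u).trans nu) ?_ (norm_nonneg _) (by positivity))
      exact (D.norm_L' _ _).trans (by gcongr)
    have e2 : Real.exp (2 * N) = Real.exp N * Real.exp N := by rw [← Real.exp_add]; ring_nf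
    have := norm_sub_le w2 (D.R q r + D.L q r + D.L (D.j u) (D.L q u))
    have := norm_add₃_le (a := D.R q r) (b := D.L q r) (c := D.L (D.j u) (D.L q u))
    rw [Real.exp_add, e2]
    rw [e2] at b1 b2
    linarith
  have sX := hE.sa X hX
  have sZ := hE.sa Z hZ
  have hgh : (ex (s • D.j X) * ex ((1/2 : ℝ) • D.j Z)) * (ex ((-(1/2) : ℝ) • D.j Z) * ex ((-s) • D.j X)) = 1 := by
    rw [mul_assoc, ← mul_assoc (ex ((1/2 : ℝ) • D.j Z)), hm1, one_mul, ex_smul_mul]; simp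
  have hhg : (ex ((-(1/2) : ℝ) • D.j Z) * ex ((-s) • D.j X)) * (ex (s • D.j X) * ex ((1/2 : ℝ) • D.j Z)) = 1 := by
    rw [mul_assoc, ← mul_assoc (ex ((-s) • D.j X)), ex_smul_mul, neg_add_cancel, zero_smul, ex_zero, one_mul, hm2]
  have hp : ex (s • D.j X) * q * ex (s • D.j X) = (ex (s • D.j X) * ex ((1/2 : ℝ) • D.j Z)) *
      star (ex (s • D.j X) * ex ((1/2 : ℝ) • D.j Z)) := by
    rw [star_mul, D.star_ex_smul sX, D.star_ex_smul sZ, hq, ← half_sq (D.j Z)]; noncomm_ring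
  have nh : ‖ex ((-(1/2) : ℝ) • D.j Z) * ex ((-s) • D.j X)‖ *
      ‖ex ((-(1/2) : ℝ) • D.j Z) * ex ((-s) • D.j X)‖ ≤ Real.exp (R + 2 * N) := by
    have a1 : ‖ex ((-(1/2) : ℝ) • D.j Z)‖ ≤ Real.exp (R / 2) := by
      apply norm_ex_le_of; rw [norm_smul]; norm_num; linarith [D.norm_j Z]
    have a2 : ‖ex ((-s) • D.j X)‖ ≤ Real.exp N := by
      apply norm_ex_le_of; rw [norm_smul, norm_neg, Real.norm_of_nonneg hs0]
      exact (mul_le_of_le_one_left (norm_nonneg _) hs1).trans (D.norm_j X)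
    have a3 : ‖ex ((-(1/2) : ℝ) • D.j Z) * ex ((-s) • D.j X)‖ ≤ Real.exp (R / 2 + N) := by
      rw [Real.exp_add]
      exact (norm_mul_le _ _).trans (mul_le_mul a1 a2 (norm_nonneg _) (Real.exp_pos _).le)
    calc _ ≤ Real.exp (R / 2 + N) * Real.exp (R / 2 + N) := by gcongr
      _ = _ := by rw [← Real.exp_add]; ring_nf
  have tot : ‖ex ((-(1/2) : ℝ) • D.j Z) * ex ((-s) • D.j X)‖ *
      ‖ex ((-(1/2) : ℝ) • D.j Z) * ex ((-s) • D.j X)‖ * ‖w‖ ≤ Real.exp (R + 2 * N) *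
      ((5 * Real.exp (R + 2 * N) * N ^ 2 + 2 * Real.exp (5 * R + 2 * M) * M ^ 2) * s ^ 2) :=
    mul_le_mul nh nw (norm_nonneg _) (Real.exp_pos _).le
  have := dd_le hgh hhg hp (PP.ex (sZ.add ((hE.sa U hU).smul s))) ew (by linarith)
  linarith

lemma ex_smul_PP {X : G} (sX : D.SA X) (s : ℝ) : D.PP (ex (s • D.j X)) :=
  ⟨s • X, sX.smul s, by rw [map_smul]⟩

lemma dd_conj_ex {X : G} (sX : D.SA X) (s : ℝ) {p q : B} (hp : D.PP p) (hq : D.PP q) :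
    D.dd (ex (s • D.j X) * p * ex (s • D.j X)) (ex (s • D.j X) * q * ex (s • D.j X)) = D.dd p q := by
  have h1 : ex (s • D.j X) * ex ((-s) • D.j X) = 1 := by rw [ex_smul_mul]; simp
  have h2 : ex ((-s) • D.j X) * ex (s • D.j X) = 1 := by rw [ex_smul_mul]; simp
  have := dd_conj hp hq h1 h2
  rwa [D.star_ex_smul sX] at this

lemma LT.conj (hE : D.LT E) {X Y : G} (hX : X ∈ E) (hY : Y ∈ E) :
    ∃ Z ∈ E, ex (D.j X) * ex (D.j Y) * ex (D.j X) = ex (D.j Z) := by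
  have sX := hE.sa X hX
  have sY := hE.sa Y hY
  obtain ⟨K, hK0, hK⟩ := hE.step hX (2 * ‖X‖ + ‖Y‖ + 1)
  obtain ⟨W, sW, eW⟩ := (PP.ex sX).conj (PP.ex sY)
  refine ⟨W, ?_, eW⟩
  have hq : ∀ t : ℝ, D.PP (ex (t • D.j X) * ex (D.j Y) * ex (t • D.j X)) := fun t =>
    (ex_smul_PP sX t).conj (PP.ex sY)
  have hq1 : ∀ t : ℝ, 0 ≤ t → t ≤ 1 → D.dd 1 (ex (t • D.j X) * ex (D.j Y) * ex (t • D.j X)) ≤ 2 * ‖X‖ + ‖Y‖ := by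
    intro t ht0 ht1
    have p1 : D.PP (1 : B) := ⟨0, D.SA_zero, by simp [ex_zero]⟩
    have h := dd_triangle p1 ((ex_smul_PP sX t).conj p1) (hq t)
    rw [dd_conj_ex sX t p1 (PP.ex sY), dd_one sY] at h
    have e2 : ex (t • D.j X) * 1 * ex (t • D.j X) = ex (D.j ((t + t) • X)) := by
      rw [mul_one, ex_smul_mul, map_smul]
    rw [e2, dd_one (sX.smul _), norm_smul, Real.norm_of_nonneg (by linarith)] at h
    nlinarith [norm_nonneg X]
  have main : ∀ n : ℕ, 1 ≤ n → K ≤ n → ∃ Z ∈ E, ‖Z - W‖ ≤ K / n := by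
    intro n hn hKn
    have hn0 : (0 : ℝ) < n := by exact_mod_cast hn
    have hn1 : (1 : ℝ) ≤ n := by exact_mod_cast hn
    set s : ℝ := 1 / n with hs
    have hs0 : 0 < s := by positivity
    have hs1 : s ≤ 1 := by rw [hs, div_le_one hn0]; exact hn1
    have hsn : n * s = 1 := by rw [hs]; field_simp
    have hKs : K * s ≤ 1 := by
      rw [hs, mul_one_div, div_le_one hn0]; exact hKn
    have hKs2 : K * s ^ 2 ≤ 1 := by nlinarith
    have ind : ∀ k : ℕ, k ≤ n → ∃ Z ∈ E, D.dd (ex ((k * s) • D.j X) * ex (D.j Y) * ex ((k * s) • D.j X)) (ex (D.j Z)) ≤ k * (K * s ^ 2) := by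
      intro k
      induction k with
      | zero =>
        intro _
        refine ⟨Y, hY, ?_⟩
        have : D.dd (ex (D.j Y)) (ex (D.j Y)) = 0 := by
          have : D.dd (ex (D.j Y)) (ex (D.j Y)) = ‖(0 : G)‖ :=
            Rep.dd_eq ⟨_, _, hm1 (D.j Y), hm2 (D.j Y), D.SA_zero, by rw [D.star_ex_smul sY, half_sq],
              by rw [D.star_ex_smul sY, map_zero, ex_zero, mul_one, half_sq]⟩
          rw [this, norm_zero]
        simp [ex_zero, this]
      | succ k ih =>
        intro hk
        obtain ⟨Z, hZ, hd⟩ := ih (by omega)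
        have hkn : (k : ℝ) ≤ n := by exact_mod_cast (by omega : k ≤ n)
        have hks : (k : ℝ) * s ≤ 1 := by nlinarith
        have hks0 : (0 : ℝ) ≤ k * s := by positivity
        have hle : (k : ℝ) * (K * s ^ 2) ≤ 1 := by
          calc (k : ℝ) * (K * s ^ 2) = (k * s) * (K * s) := by ring
            _ ≤ 1 := by apply mul_le_one₀ hks (by positivity) hKs
        have sZ := hE.sa Z hZ
        have hZn : ‖Z‖ ≤ 2 * ‖X‖ + ‖Y‖ + 1 := by
          have p1 : D.PP (1 : B) := ⟨0, D.SA_zero, by simp [ex_zero]⟩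
          have h := dd_triangle p1 (hq (k * s)) (PP.ex sZ)
          rw [dd_one sZ] at h
          linarith [hq1 (k * s) hks0 hks]
        obtain ⟨Z', hZ', hd'⟩ := hK Z hZ hZn s hs0.le hs1 hKs2
        refine ⟨Z', hZ', ?_⟩
        have e : ex (((k + 1 : ℕ) * s) • D.j X) * ex (D.j Y) * ex (((k + 1 : ℕ) * s) • D.j X) =
          ex (s • D.j X) * (ex ((k * s) • D.j X) * ex (D.j Y) * ex ((k * s) • D.j X)) * ex (s • D.j X) := by
          have e1 : (((k + 1 : ℕ) : ℝ) * s) = s + k * s := by push_cast; ring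
          have e2 : (((k + 1 : ℕ) : ℝ) * s) = k * s + s := by push_cast; ring
          nth_rewrite 1 [e1]
          rw [e2, ← ex_smul_mul, ← ex_smul_mul]; noncomm_ring
        rw [e]
        have h := dd_triangle ((ex_smul_PP sX s).conj (hq (k * s))) ((ex_smul_PP sX s).conj (PP.ex sZ)) (PP.ex (hE.sa Z' hZ'))
        rw [dd_conj_ex sX s (hq (k * s)) (PP.ex sZ)] at h
        push_cast
        linarith
    obtain ⟨Z, hZ, hd⟩ := ind n le_rfl
    refine ⟨Z, hZ, ?_⟩
    rw [hsn, one_smul, eW] at hd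
    refine (dd_emi sW (hE.sa Z hZ)).trans (hd.trans (le_of_eq ?_))
    rw [hs]; field_simp
  have : W ∈ closure (E : Set G) := by
    rw [Metric.mem_closure_iff]
    intro ε hε
    obtain ⟨n, hn⟩ := exists_nat_gt (max (K / ε) (max K 1))
    have h1 : K / ε < n := (le_max_left _ _).trans_lt hn
    have h2 : K < n := ((le_max_left _ _).trans (le_max_right _ _)).trans_lt hn
    have h3 : (1 : ℝ) < n := ((le_max_right _ _).trans (le_max_right _ _)).trans_lt hn
    obtain ⟨Z, hZ, hz⟩ := main n (by exact_mod_cast h3.le) h2.le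
    refine ⟨Z, hZ, ?_⟩
    rw [dist_comm, dist_eq_norm]
    refine hz.trans_lt ?_
    rw [div_lt_iff₀ (by linarith)]
    rw [div_lt_iff₀ hε] at h1
    linarith
  rwa [hE.cl.closure_eq] at this

end euler
end HSData
end Part7

section Part8
set_option linter.unusedSectionVars false
open scoped InnerProductSpace
open MeasureTheory Filter Topology
namespace HSData
local notation "ex" => NormedSpace.exp

section main
variable {B G : Type*} [CStarAlgebra B] [NormedAddCommGroup G]
    [InnerProductSpace ℝ G] (D : HSData B G) [CompleteSpace G]
 [PartialOrder B] [StarOrderedRing B] {α : Type*} {l : Filter α}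

/-- convergence in the HS norm -/
def HT (x : α → B) (l : Filter α) (x0 : B) : Prop :=
  ∃ w : α → G, (∀ i, D.j (w i) = x i - x0) ∧ Tendsto w l (𝓝 0)

variable {D}

lemma HT.const (x0 : B) : D.HT (fun _ : α => x0) l x0 := ⟨fun _ => 0, by simp, tendsto_const_nhds⟩

lemma HT.mul {x y : α → B} {x0 y0 : B} (hx : D.HT x l x0) (hy : D.HT y l y0) :
    D.HT (fun i => x i * y i) l (x0 * y0) := by
  obtain ⟨w1, e1, t1⟩ := hx
  obtain ⟨w2, e2, t2⟩ := hy
  refine ⟨fun i => D.L (D.j (w1 i)) (w2 i) + D.L x0 (w2 i) + D.R y0 (w1 i), ?_, ?_⟩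
  · intro i
    simp only [map_add D.j, D.j_L, D.j_R]
    rw [e1, e2]; noncomm_ring
  · have h1 : Tendsto (fun i => D.L (D.j (w1 i))) l (𝓝 (D.L (D.j 0))) :=
      ((D.L.continuous.comp D.j.continuous).tendsto 0).comp t1
    have h2 := (isBoundedBilinearMap_apply.continuous.tendsto (D.L (D.j 0), (0 : G))).comp (h1.prodMk_nhds t2)
    have h3 := ((D.L x0).continuous.tendsto 0).comp t2
    have h4 := ((D.R y0).continuous.tendsto 0).comp t1
    simpa using (h2.add h3).add h4

lemma HT.ex {X : α → G} {X0 : G} (h : Tendsto X l (𝓝 X0)) :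
    D.HT (fun i => ex (D.j (X i))) l (ex (D.j X0)) := by
  choose w h1 h2 using fun i => D.ex_sub X0 (X i)
  refine ⟨w, h1, squeeze_zero_norm h2 ?_⟩
  have h3 : Tendsto (fun i => Real.exp (‖X0‖ + ‖X i‖) * ‖X i - X0‖) l
      (𝓝 (Real.exp (‖X0‖ + ‖X0‖) * ‖X0 - X0‖)) :=
    ((Real.continuous_exp.tendsto _).comp (tendsto_const_nhds.add h.norm)).mul (h.sub tendsto_const_nhds).norm
  simpa using h3

lemma HT.dd {q : α → B} {p : B} (h : D.HT q l p) (hp : D.PP p) (hq : ∀ i, D.PP (q i)) :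
    Tendsto (fun i => D.dd p (q i)) l (𝓝 0) := by
  obtain ⟨w, ew, tw⟩ := h
  obtain ⟨g, k, hg, hk, sg, -, e, -, -⟩ := hp.sqrt
  have h1 : Tendsto (fun i => ‖k‖ * ‖k‖ * ‖w i‖) l (𝓝 0) := by
    have := (tendsto_const_nhds (x := ‖k‖ * ‖k‖) (f := l)).mul tw.norm
    simpa using this
  have h2 : ∀ᶠ i in l, ‖k‖ * ‖k‖ * ‖w i‖ ≤ 1/2 := h1.eventually_le_const (by norm_num)
  refine squeeze_zero' (Eventually.of_forall fun i => dd_nonneg _ _) (h2.mono fun i hi => 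
    dd_le hg hk (by rw [sg]; exact e) (hq i) (ew i) hi) ?_
  simpa using h1.const_mul 2

lemma HT.log {X : α → G} {X0 : G} (hX : ∀ i, D.SA (X i)) (hX0 : D.SA X0)
    (h : D.HT (fun i => NormedSpace.exp (D.j (X i))) l (NormedSpace.exp (D.j X0))) :
    Tendsto X l (𝓝 X0) := by
  rw [tendsto_iff_norm_sub_tendsto_zero]
  exact squeeze_zero (fun _ => norm_nonneg _) (fun i => dd_emi hX0 (hX i))
    (h.dd (PP.ex hX0) fun i => PP.ex (hX i))

variable {E : Submodule ℝ G}

lemma LT.mid (hE : D.LT E) {p : B} (hp : D.PP p) {Z Z' : G} (hZ : Z ∈ E) (hZ' : Z' ∈ E) :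
    ∃ M ∈ E, D.dd (ex (D.j Z)) (ex (D.j Z')) ^ 2 + 4 * D.dd (ex (D.j M)) p ^ 2 ≤
      2 * D.dd (ex (D.j Z)) p ^ 2 + 2 * D.dd (ex (D.j Z')) p ^ 2 := by
  have sZ := hE.sa Z hZ
  obtain ⟨W0, hW0, e0⟩ := hE.conj (E.smul_mem (-(1/2) : ℝ) hZ) hZ'
  have hW : (1/2 : ℝ) • W0 ∈ E := E.smul_mem _ hW0
  obtain ⟨M, hM, eM⟩ := hE.conj (E.smul_mem (1/2 : ℝ) hZ) hW
  set W := (1/2 : ℝ) • W0 with hWd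
  have sW := hE.sa W hW
  have eW : D.j W0 = (2 : ℝ) • D.j W := by rw [hWd, map_smul, smul_smul]; norm_num
  rw [map_smul] at e0 eM
  set a := ex ((1/2 : ℝ) • D.j Z) with ha
  set a' := ex ((-(1/2) : ℝ) • D.j Z) with ha'
  have h1 : a * a' = 1 := hm1 _
  have h2 : a' * a = 1 := hm2 _
  have sa : star a = a := D.star_ex_smul sZ _
  set u := ex ((1/2 : ℝ) • D.j W) with hu
  set u' := ex ((-(1/2) : ℝ) • D.j W) with hu'
  have h3 : u * u' = 1 := hm1 _
  have h4 : u' * u = 1 := hm2 _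
  have su : star u = u := D.star_ex_smul sW _
  refine ⟨M, hM, ?_⟩
  have hk : (a * u) * (u' * a') = 1 := by
    calc _ = a * (u * u') * a' := by noncomm_ring
      _ = 1 := by rw [h3, mul_one, h1]
  have hl : (u' * a') * (a * u) = 1 := by
    calc _ = u' * (a' * a) * u := by noncomm_ring
      _ = 1 := by rw [h2, mul_one, h4]
  have ek : (a * u) * star (a * u) = ex (D.j M) := by
    rw [star_mul, sa, su, ← eM, ← half_sq (D.j W)]; noncomm_ring
  obtain ⟨w, hw⟩ := hp.sub (PP.ex (hE.sa M hM))
  obtain ⟨V, sV, eV, -⟩ := D.rep hk hl (w := w) (by rw [hw, ek]) hp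
  have key := semipar hk hl sV sW
  rw [← eV, ek] at key
  have k1 : a * u * ex (D.j (-W)) * star (a * u) = ex (D.j Z) := by
    rw [star_mul, sa, su, ← half_sq (D.j Z), map_neg, ← half_sq (-D.j W)]
    have : ex ((1/2 : ℝ) • -D.j W) = u' := by rw [hu', smul_neg, neg_smul]
    rw [this]
    calc _ = a * (u * u') * (u' * u) * a := by noncomm_ring
      _ = _ := by rw [h3, h4, mul_one, mul_one]
  have k2 : a * u * ex (D.j W) * star (a * u) = ex (D.j Z') := by
    have e3 : u * ex (D.j W) * u = ex (D.j W0) := by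
      rw [eW, ← half_sq (D.j W), ← half_sq ((2 : ℝ) • D.j W), smul_smul]
      norm_num
      rw [← half_sq (D.j W)]; noncomm_ring
    calc _ = a * (u * ex (D.j W) * u) * a := by rw [star_mul, sa, su]; noncomm_ring
      _ = (a * a') * ex (D.j Z') * (a' * a) := by rw [e3, ← e0]; noncomm_ring
      _ = _ := by rw [h1, h2, one_mul, mul_one]
  rw [k1, k2] at key
  exact key

lemma LT.exists_min (hE : D.LT E) {p : B} (hp : D.PP p) :
    ∃ X ∈ E, ∀ Y ∈ E, D.dd (ex (D.j X)) p ≤ D.dd (ex (D.j Y)) p := by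
  set f : E → ℝ := fun Z => D.dd (ex (D.j (Z : G))) p with hf
  have hbdd : BddBelow (Set.range f) := ⟨0, by rintro _ ⟨Z, rfl⟩; exact dd_nonneg _ _⟩
  set I := ⨅ Z, f Z with hI
  have hI0 : 0 ≤ I := Real.iInf_nonneg fun Z => dd_nonneg _ _
  have hIle : ∀ Z : E, I ≤ f Z := fun Z => ciInf_le hbdd Z
  have hex : ∀ n : ℕ, ∃ Z : E, f Z < I + 1 / ((n : ℝ) + 1) := fun n =>
    exists_lt_of_ciInf_lt (lt_add_of_pos_right _ (by positivity))
  choose x hx using hex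
  have hx1 : ∀ n N : ℕ, N ≤ n → f (x n) ^ 2 ≤ (I + 1 / ((N : ℝ) + 1)) ^ 2 := by
    intro n N h
    have : 1 / ((n : ℝ) + 1) ≤ 1 / ((N : ℝ) + 1) := Nat.one_div_le_one_div h
    have := hx n
    have := dd_nonneg (D := D) (ex (D.j (x n : G))) p
    apply pow_le_pow_left₀ (dd_nonneg _ _); linarith
  have tη := tendsto_one_div_add_atTop_nhds_zero_nat (𝕜 := ℝ)
  have hc : CauchySeq fun n => (x n : G) := by
    refine cauchySeq_of_le_tendsto_0 (fun N : ℕ => Real.sqrt (4 * (I + 1 / ((N : ℝ) + 1)) ^ 2 - 4 * I ^ 2)) ?_ ?_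
    · intro n m N hn hm
      obtain ⟨M, hM, h⟩ := hE.mid hp (x n).2 (x m).2
      apply Real.le_sqrt_of_sq_le
      have h1 := dd_emi (hE.sa _ (x n).2) (hE.sa _ (x m).2)
      rw [dist_comm, dist_eq_norm]
      have h2 : ‖(x m : G) - x n‖ ^ 2 ≤ D.dd (ex (D.j (x n : G))) (ex (D.j (x m : G))) ^ 2 := by gcongr
      have h3 : I ^ 2 ≤ D.dd (ex (D.j M)) p ^ 2 := by
        have := hIle ⟨M, hM⟩
        apply pow_le_pow_left₀ hI0 this
      have h4 := hx1 n N hn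
      have h5 := hx1 m N hm
      simp only [hf] at h4 h5
      linarith
    · have : Tendsto (fun N : ℕ => Real.sqrt (4 * (I + 1 / ((N : ℝ) + 1)) ^ 2 - 4 * I ^ 2)) atTop
        (𝓝 (Real.sqrt (4 * (I + 0) ^ 2 - 4 * I ^ 2))) :=
        (Real.continuous_sqrt.tendsto _).comp
          ((((tendsto_const_nhds.add tη).pow 2).const_mul 4).sub tendsto_const_nhds)
      simpa using this
  obtain ⟨X, hX⟩ := cauchySeq_tendsto_of_complete hc
  have hXE : X ∈ E := hE.cl.mem_of_tendsto hX (Eventually.of_forall fun n => (x n).2)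
  refine ⟨X, hXE, fun Y hY => le_trans ?_ (hIle ⟨Y, hY⟩)⟩
  have t1 := (HT.ex (D := D) hX).dd (PP.ex (hE.sa X hXE)) fun n => PP.ex (hE.sa _ (x n).2)
  have t2 : Tendsto (fun n : ℕ => D.dd (ex (D.j X)) (ex (D.j (x n : G))) + (I + 1 / ((n : ℝ) + 1))) atTop
      (𝓝 (0 + (I + 0))) := t1.add (tendsto_const_nhds.add tη)
  rw [zero_add, add_zero] at t2
  refine ge_of_tendsto' t2 fun n => ?_
  refine (dd_triangle (PP.ex (hE.sa X hXE)) (PP.ex (hE.sa _ (x n).2)) hp).trans ?_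
  have := (hx n).le
  simp only [hf] at this
  linarith

lemma LT.firstvar (hE : D.LT E) {V : G} (sV : D.SA V)
    (hmin : ∀ Y ∈ E, ‖V‖ ≤ D.dd (ex (D.j Y)) (ex (D.j V))) {Y : G} (hY : Y ∈ E) :
    ⟪V, Y⟫_ℝ ≤ 0 := by
  have sY := hE.sa Y hY
  have hP : ∀ t : ℝ, D.PP (ex (D.j ((-t/2) • Y)) * ex (D.j V) * ex (D.j ((-t/2) • Y))) := fun t =>
    (PP.ex (sY.smul _)).conj (PP.ex sV)
  choose W sW eW using hP
  have tW : Tendsto W (𝓝[>] 0) (𝓝 V) := by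
    apply HT.log sW sV
    have t0 : Tendsto (fun t : ℝ => (-t/2) • Y) (𝓝[>] 0) (𝓝 0) := by
      have : Continuous fun t : ℝ => (-t/2) • Y := by fun_prop
      have := this.tendsto 0
      simp only [neg_zero, zero_div, zero_smul] at this
      exact this.mono_left nhdsWithin_le_nhds
    have t1 := HT.ex (D := D) t0
    have t2 := (t1.mul (HT.const (ex (D.j V)))).mul t1
    simp only [eW] at t2
    simpa [ex_zero] using t2
  have hle : ∀ t : ℝ, 0 < t → ⟪W t, Y⟫_ℝ ≤ 0 := by
    intro t ht
    have p1 : D.PP (1 : B) := ⟨0, D.SA_zero, by simp⟩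
    have f1 : ‖V‖ ≤ ‖W t‖ := by
      have h := hmin (t • Y) (E.smul_mem _ hY)
      rw [← dd_conj_ex sY (-t/2) (PP.ex (sY.smul t)) (PP.ex sV), ← map_smul, eW,
        map_smul, map_smul, ex_smul_mul, ex_smul_mul] at h
      have : -t/2 + t + -t/2 = 0 := by ring
      rwa [this, zero_smul, ex_zero, dd_one (sW t)] at h
    have f2 : ‖W t - (-t) • Y‖ ≤ ‖V‖ := by
      refine (dd_emi (sY.smul _) (sW t)).trans (le_of_eq ?_)
      rw [← eW, ← dd_one sV, ← dd_conj_ex sY (-t/2) p1 (PP.ex sV), mul_one, ex_smul_mul, map_smul, map_smul]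
      congr 3; ring
    have f3 : ‖W t - (-t) • Y‖ ^ 2 ≤ ‖W t‖ ^ 2 := by
      apply pow_le_pow_left₀ (norm_nonneg _); linarith
    rw [norm_sub_sq_real, inner_smul_right] at f3
    have f4 : 0 ≤ ‖(-t) • Y‖ ^ 2 := by positivity
    nlinarith
  refine le_of_tendsto (tW.inner tendsto_const_nhds) ?_
  filter_upwards [self_mem_nhdsWithin] with t ht
  exact hle t ht

/-- existence of the decomposition -/
lemma LT.exists_decomp (hE : D.LT E) {p : B} (hp : D.PP p) :
    ∃ A ∈ E, ∃ V, D.SA V ∧ (∀ Y ∈ E, ⟪Y, V⟫_ℝ = 0) ∧ p = ex (D.j A) * ex (D.j V) * ex (D.j A) := by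
  obtain ⟨X, hX, hmin⟩ := hE.exists_min hp
  have sX := hE.sa X hX
  obtain ⟨V, sV, eV⟩ := (ex_smul_PP sX (-(1/2))).conj hp
  have hm : ∀ Y ∈ E, ‖V‖ ≤ D.dd (ex (D.j Y)) (ex (D.j V)) := by
    intro Y hY
    obtain ⟨Z, hZ, eZ⟩ := hE.conj (E.smul_mem (1/2 : ℝ) hX) hY
    have h := hmin Z hZ
    rw [← dd_conj_ex sX (-(1/2)) (PP.ex (hE.sa Z hZ)) hp, ← dd_conj_ex sX (-(1/2)) (PP.ex sX) hp, eV, ← eZ, map_smul] at h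
    have e1 : ex ((-(1/2) : ℝ) • D.j X) * ex (D.j X) * ex ((-(1/2) : ℝ) • D.j X) = 1 := by
      rw [← half_sq (D.j X), ← mul_assoc, hm2, one_mul, hm1]
    have e2 : ex ((-(1/2) : ℝ) • D.j X) * (ex ((1/2 : ℝ) • D.j X) * ex (D.j Y) * ex ((1/2 : ℝ) • D.j X)) *
      ex ((-(1/2) : ℝ) • D.j X) = ex (D.j Y) := by
      calc _ = (ex ((-(1/2) : ℝ) • D.j X) * ex ((1/2 : ℝ) • D.j X)) * ex (D.j Y) * (ex ((1/2 : ℝ) • D.j X) * ex ((-(1/2) : ℝ) • D.j X)) := by noncomm_ring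
        _ = _ := by rw [hm1, hm2, one_mul, mul_one]
    rwa [e1, e2, dd_one sV] at h
  refine ⟨(1/2 : ℝ) • X, E.smul_mem _ hX, V, sV, fun Y hY => ?_, ?_⟩
  · rw [real_inner_comm]
    have h1 := hE.firstvar sV hm hY
    have h2 := hE.firstvar sV hm (E.neg_mem hY)
    rw [inner_neg_right] at h2
    linarith
  · rw [← eV, map_smul]
    calc p = (ex ((1/2 : ℝ) • D.j X) * ex ((-(1/2) : ℝ) • D.j X)) * p * (ex ((-(1/2) : ℝ) • D.j X) * ex ((1/2 : ℝ) • D.j X)) := by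
          rw [hm1, hm2, one_mul, mul_one]
      _ = _ := by noncomm_ring

lemma LT.pyth (hE : D.LT E) {A A' V : G} (hA : A ∈ E) (hA' : A' ∈ E) (sV : D.SA V)
    (hV : ∀ Y ∈ E, ⟪Y, V⟫_ℝ = 0) :
    D.dd (ex ((2 : ℝ) • D.j A)) (ex (D.j A) * ex (D.j V) * ex (D.j A)) = ‖V‖ ∧
    ‖(2 : ℝ) • A' - (2 : ℝ) • A‖ ^ 2 + ‖V‖ ^ 2 ≤ D.dd (ex ((2 : ℝ) • D.j A')) (ex (D.j A) * ex (D.j V) * ex (D.j A)) ^ 2 := by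
  have sA := hE.sa A hA
  have sA' := hE.sa A' hA'
  have p1 : D.PP (1 : B) := ⟨0, D.SA_zero, by simp⟩
  have e2 : ex ((2 : ℝ) • D.j A) = ex ((1 : ℝ) • D.j A) * 1 * ex ((1 : ℝ) • D.j A) := by
    rw [mul_one, ex_smul_mul]; norm_num
  have e3 : ex (D.j A) = ex ((1 : ℝ) • D.j A) := by rw [one_smul]
  have hd : ∀ q, D.PP q → D.dd (ex ((2 : ℝ) • D.j A)) (ex (D.j A) * q * ex (D.j A)) = D.dd 1 q := by
    intro q hq
    rw [e2, e3, dd_conj_ex sA 1 p1 hq]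
  refine ⟨by rw [hd _ (PP.ex sV), dd_one sV], ?_⟩
  obtain ⟨Y, hY, eY⟩ := hE.conj (E.neg_mem hA) (E.smul_mem (2 : ℝ) hA')
  have sY := hE.sa Y hY
  have eA' : ex ((2 : ℝ) • D.j A') = ex (D.j A) * ex (D.j Y) * ex (D.j A) := by
    rw [← eY, map_neg, map_smul]
    calc _ = (ex (D.j A) * ex (-D.j A)) * ex ((2 : ℝ) • D.j A') * (ex (-D.j A) * ex (D.j A)) := by
          rw [ex_mul_neg, ex_neg_mul, one_mul, mul_one]
      _ = _ := by noncomm_ring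
  have h1 := dd_emi (sA.smul 2) (sA'.smul 2)
  rw [map_smul, map_smul, eA', hd _ (PP.ex sY), dd_one sY] at h1
  have h2 : D.dd (ex ((2 : ℝ) • D.j A')) (ex (D.j A) * ex (D.j V) * ex (D.j A)) = D.dd (ex (D.j Y)) (ex (D.j V)) := by
    rw [eA', e3, dd_conj_ex sA 1 (PP.ex sY) (PP.ex sV)]
  rw [h2]
  have h3 := dd_emi sY sV
  have h4 : ‖V - Y‖ ^ 2 ≤ D.dd (ex (D.j Y)) (ex (D.j V)) ^ 2 := by gcongr
  have h5 : ‖(2 : ℝ) • A' - (2 : ℝ) • A‖ ^ 2 ≤ ‖Y‖ ^ 2 := by gcongr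
  rw [norm_sub_sq_real, real_inner_comm, hV Y hY] at h4
  linarith

lemma LT.key (hE : D.LT E) {A A' V V' : G} (hA : A ∈ E) (hA' : A' ∈ E) (sV : D.SA V)
    (hV : ∀ Y ∈ E, ⟪Y, V⟫_ℝ = 0) (sV' : D.SA V') (hV' : ∀ Y ∈ E, ⟪Y, V'⟫_ℝ = 0) :
    4 * ‖A' - A‖ ^ 2 ≤ 4 * D.dd (ex (D.j A) * ex (D.j V) * ex (D.j A))
      (ex (D.j A') * ex (D.j V') * ex (D.j A')) * ‖V‖ + 4 * D.dd (ex (D.j A) * ex (D.j V) * ex (D.j A))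
      (ex (D.j A') * ex (D.j V') * ex (D.j A')) ^ 2 := by
  have sA := hE.sa A hA
  have sA' := hE.sa A' hA'
  obtain ⟨h1, h2⟩ := hE.pyth hA hA' sV hV
  obtain ⟨h3, h4⟩ := hE.pyth hA' hA sV' hV'
  have P1 : D.PP (ex ((2 : ℝ) • D.j A)) := ex_smul_PP sA 2
  have P2 : D.PP (ex ((2 : ℝ) • D.j A')) := ex_smul_PP sA' 2
  have P3 : D.PP (ex (D.j A) * ex (D.j V) * ex (D.j A)) := (PP.ex sA).conj (PP.ex sV)
  have P4 : D.PP (ex (D.j A') * ex (D.j V') * ex (D.j A')) := (PP.ex sA').conj (PP.ex sV')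
  have t1 := dd_triangle P1 P3 P4
  have t2 := dd_triangle P2 P4 P3
  rw [dd_symm (ex (D.j A') * ex (D.j V') * ex (D.j A'))] at t2
  have n0 := dd_nonneg (D := D) (ex ((2 : ℝ) • D.j A')) (ex (D.j A) * ex (D.j V) * ex (D.j A))
  have n1 := dd_nonneg (D := D) (ex ((2 : ℝ) • D.j A)) (ex (D.j A') * ex (D.j V') * ex (D.j A'))
  rw [h1] at t1
  rw [h3] at t2
  have h5 : ‖V'‖ ≤ D.dd (ex ((2 : ℝ) • D.j A)) (ex (D.j A') * ex (D.j V') * ex (D.j A')) := by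
    refine (pow_le_pow_iff_left₀ (norm_nonneg _) n1 two_ne_zero).1 ?_
    nlinarith [sq_nonneg ‖(2 : ℝ) • A - (2 : ℝ) • A'‖]
  rw [← smul_sub, norm_smul, mul_pow] at h2
  norm_num at h2
  set δ := D.dd (ex (D.j A) * ex (D.j V) * ex (D.j A)) (ex (D.j A') * ex (D.j V') * ex (D.j A'))
  have h6 : D.dd (ex ((2 : ℝ) • D.j A')) (ex (D.j A) * ex (D.j V) * ex (D.j A)) ^ 2 ≤ (‖V‖ + 2 * δ) ^ 2 := by
    apply pow_le_pow_left₀ n0; linarith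
  nlinarith

lemma dd_self {p : B} (hp : D.PP p) : D.dd p p = 0 := by
  obtain ⟨g, k, hg, hk, sg, -, e, -, -⟩ := hp.sqrt
  have : D.dd p p = ‖(0 : G)‖ :=
    Rep.dd_eq ⟨g, k, hg, hk, D.SA_zero, by rw [sg, e], by rw [sg, map_zero, ex_zero, mul_one, e]⟩
  rw [this, norm_zero]

lemma recover (A V : G) : ex (D.j (-A)) * (ex (D.j A) * ex (D.j V) * ex (D.j A)) * ex (D.j (-A)) = ex (D.j V) := by
  rw [map_neg]
  calc _ = (ex (-D.j A) * ex (D.j A)) * ex (D.j V) * (ex (D.j A) * ex (-D.j A)) := by noncomm_ring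
    _ = _ := by rw [ex_mul_neg, ex_neg_mul, one_mul, mul_one]

lemma LT.unique (hE : D.LT E) {A A' V V' : G} (hA : A ∈ E) (hA' : A' ∈ E) (sV : D.SA V)
    (hV : ∀ Y ∈ E, ⟪Y, V⟫_ℝ = 0) (sV' : D.SA V') (hV' : ∀ Y ∈ E, ⟪Y, V'⟫_ℝ = 0)
    (h : ex (D.j A) * ex (D.j V) * ex (D.j A) = ex (D.j A') * ex (D.j V') * ex (D.j A')) :
    A' = A ∧ ex (D.j V') = ex (D.j V) := by
  have k := hE.key hA hA' sV hV sV' hV'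
  rw [← h, dd_self ((PP.ex (hE.sa A hA)).conj (PP.ex sV))] at k
  have e : A' = A := by
    rw [← sub_eq_zero, ← norm_eq_zero]
    have : ‖A' - A‖ ^ 2 = 0 := le_antisymm (by linarith) (by positivity)
    exact pow_eq_zero_iff (two_ne_zero) |>.1 this
  refine ⟨e, ?_⟩
  rw [← recover (D := D) A' V', ← h, e, recover]

lemma LT.cont_inv (hE : D.LT E) {A V : G} (hA : A ∈ E) (sV : D.SA V)
    (hV : ∀ Y ∈ E, ⟪Y, V⟫_ℝ = 0) {A' V' : α → G} (hA' : ∀ i, A' i ∈ E)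
    (sV' : ∀ i, D.SA (V' i)) (hV' : ∀ i, ∀ Y ∈ E, ⟪Y, V' i⟫_ℝ = 0)
    (h : D.HT (fun i => ex (D.j (A' i)) * ex (D.j (V' i)) * ex (D.j (A' i))) l
      (ex (D.j A) * ex (D.j V) * ex (D.j A))) :
    D.HT (fun i => ex (D.j (A' i))) l (ex (D.j A)) ∧ D.HT (fun i => ex (D.j (V' i))) l (ex (D.j V)) := by
  have hδ := h.dd ((PP.ex (hE.sa A hA)).conj (PP.ex sV))
    (fun i => (PP.ex (hE.sa _ (hA' i))).conj (PP.ex (sV' i)))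
  have tA : Tendsto A' l (𝓝 A) := by
    rw [tendsto_iff_norm_sub_tendsto_zero]
    have t1 := ((hδ.mul_const ‖V‖).add (hδ.pow 2))
    have t2 := (Real.continuous_sqrt.tendsto _).comp t1
    norm_num at t2
    refine squeeze_zero (fun _ => norm_nonneg _) (fun i => ?_) t2
    apply Real.le_sqrt_of_sq_le
    have := hE.key hA (hA' i) sV hV (sV' i) (hV' i)
    linarith
  refine ⟨HT.ex tA, ?_⟩
  have t1 := HT.ex (D := D) tA.neg
  have t2 := (t1.mul h).mul t1
  simpa only [recover] using t2

end main
end HSData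
end Part8

section concrete
set_option linter.unusedSectionVars false
open MeasureTheory Filter Topology

/-- The coordinate model of the Hilbert space of Hilbert-Schmidt operators. -/
def HSG (H ι : Type*) [NormedAddCommGroup H] : Type _ := lp (fun _ : ι => H) 2

instance : NormedAddCommGroup (HSG H ι) := inferInstanceAs (NormedAddCommGroup (lp (fun _ : ι => H) 2))
instance : InnerProductSpace ℂ (HSG H ι) := inferInstanceAs (InnerProductSpace ℂ (lp (fun _ : ι => H) 2))
instance : CompleteSpace (HSG H ι) := inferInstanceAs (CompleteSpace (lp (fun _ : ι => H) 2))
instance : InnerProductSpace ℝ (HSG H ι) := InnerProductSpace.complexToReal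

namespace HSG

def c (v : HSG H ι) : ι → H := fun i => (show lp (fun _ : ι => H) 2 from v) i

lemma c_add (v w : HSG H ι) (i : ι) : c (v + w) i = c v i + c w i := rfl
lemma c_sub (v w : HSG H ι) (i : ι) : c (v - w) i = c v i - c w i := rfl
lemma c_smul (r : ℝ) (v : HSG H ι) (i : ι) : c (r • v) i = r • c v i := rfl
lemma ext {v w : HSG H ι} (h : ∀ i, c v i = c w i) : v = w :=
  lp.ext (funext h)

lemma hasSum (v : HSG H ι) : HasSum (fun i => ‖c v i‖ ^ 2) (‖v‖ ^ 2) := by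
  have := lp.hasSum_norm (p := 2) (by norm_num) (show lp (fun _ : ι => H) 2 from v)
  simp only [ENNReal.toReal_ofNat, Real.rpow_ofNat] at this
  exact this

lemma norm_sq (v : HSG H ι) : ‖v‖ ^ 2 = ∑' i, ‖c v i‖ ^ 2 := (hasSum v).tsum_eq.symm

def mk (f : ι → H) (h : Summable fun i => ‖f i‖ ^ 2) : HSG H ι :=
  (⟨f, memℓp_gen (by simpa using h)⟩ : lp (fun _ : ι => H) 2)

lemma c_mk (f : ι → H) (h : Summable fun i => ‖f i‖ ^ 2) (i : ι) : c (mk f h) i = f i := rfl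

lemma hasSum_inner (v w : HSG H ι) :
    HasSum (fun i => inner ℂ (c v i) (c w i)) (inner ℂ v w) :=
  lp.hasSum_inner (𝕜 := ℂ) (show lp (fun _ : ι => H) 2 from v) (show lp (fun _ : ι => H) 2 from w)

lemma real_inner (v w : HSG H ι) : ⟪v, w⟫_ℝ = (inner ℂ v w : ℂ).re := rfl

lemma parseval (e : HilbertBasis ι ℂ H) (x : H) :
    HasSum (fun i => ‖e.repr x i‖ ^ 2) (‖x‖ ^ 2) := by
  have := lp.hasSum_norm (p := 2) (by norm_num) (e.repr x)
  simp only [ENNReal.toReal_ofNat, Real.rpow_ofNat, LinearIsometryEquiv.norm_map] at this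
  exact this

lemma summable_repr (e : HilbertBasis ι ℂ H) (x : H) (v : HSG H ι) :
    (Summable fun i => e.repr x i • c v i) ∧ ‖∑' i, e.repr x i • c v i‖ ≤ ‖v‖ * ‖x‖ := by
  obtain ⟨C, h0, h1, h2⟩ := Real.inner_le_Lp_mul_Lq_hasSum_of_nonneg Real.HolderConjugate.two_two
    (f := fun i => ‖e.repr x i‖) (g := fun i => ‖c v i‖)
    (norm_nonneg x) (norm_nonneg v) (fun i => norm_nonneg _) (fun i => norm_nonneg _)
    (by simpa using parseval e x) (by simpa using hasSum v)
  simp only [← norm_smul] at h2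
  refine ⟨h2.summable.of_norm, ?_⟩
  refine (norm_tsum_le_tsum_norm h2.summable).trans ?_
  rw [h2.tsum_eq, mul_comm]; exact h1

lemma op_ext (e : HilbertBasis ι ℂ H) {A B : H →L[ℂ] H} (h : ∀ i, A (e i) = B (e i)) : A = B := by
  ext x
  have h1 := A.hasSum (e.hasSum_repr x)
  have h2 := B.hasSum (e.hasSum_repr x)
  simp only [map_smul, h] at h1 h2
  exact h1.unique h2

/-- The operator with given columns. -/
def op (e : HilbertBasis ι ℂ H) (v : HSG H ι) : H →L[ℂ] H :=
  LinearMap.mkContinuous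
    { toFun := fun x => ∑' i, e.repr x i • c v i
      map_add' := fun x y => by
        rw [← (summable_repr e x v).1.tsum_add (summable_repr e y v).1]
        simp [add_smul]
      map_smul' := fun r x => by
        simp only [map_smul, lp.coeFn_smul, Pi.smul_apply, smul_eq_mul, mul_smul, RingHom.id_apply]
        rw [(summable_repr e x v).1.tsum_const_smul] }
    ‖v‖ (fun x => (summable_repr e x v).2)

lemma op_basis (e : HilbertBasis ι ℂ H) (v : HSG H ι) (i : ι) : op e v (e i) = c v i := by
  classical
  change ∑' k, e.repr (e i) k • c v k = c v i
  rw [tsum_eq_single i]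
  · simp [e.repr_self]
  · intro k hk
    simp [e.repr_self, hk]

lemma norm_op_le (e : HilbertBasis ι ℂ H) (v : HSG H ι) : ‖op e v‖ ≤ ‖v‖ :=
  LinearMap.mkContinuous_norm_le _ (norm_nonneg v) _

def j (e : HilbertBasis ι ℂ H) : HSG H ι →L[ℝ] (H →L[ℂ] H) :=
  LinearMap.mkContinuous
    { toFun := op e
      map_add' := fun v w => op_ext e fun i => by simp [op_basis, c_add]
      map_smul' := fun r v => op_ext e fun i => by simp [op_basis, c_smul] }
    1 (fun v => by simpa using norm_op_le e v)

lemma j_basis (e : HilbertBasis ι ℂ H) (v : HSG H ι) (i : ι) : j e v (e i) = c v i := op_basis e v i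

lemma isHS_j (e : HilbertBasis ι ℂ H) (v : HSG H ι) : IsHS e (j e v) := by
  unfold IsHS; simp only [j_basis]; exact (hasSum v).summable

lemma hsNorm_j (e : HilbertBasis ι ℂ H) (v : HSG H ι) : hsNorm e (j e v) = ‖v‖ := by
  unfold hsNorm; simp only [j_basis]; rw [← norm_sq, Real.sqrt_sq (norm_nonneg v)]

lemma hsInner_j (e : HilbertBasis ι ℂ H) (v w : HSG H ι) :
    hsInner e (j e v) (j e w) = ⟪v, w⟫_ℝ := by
  unfold hsInner; simp only [j_basis]; rw [(hasSum_inner v w).tsum_eq, real_inner]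

def ofOp (e : HilbertBasis ι ℂ H) (A : H →L[ℂ] H) (h : IsHS e A) : HSG H ι :=
  mk (fun i => A (e i)) h

lemma j_ofOp (e : HilbertBasis ι ℂ H) (A : H →L[ℂ] H) (h : IsHS e A) : j e (ofOp e A h) = A :=
  op_ext e fun i => by rw [j_basis]; rfl

lemma j_inj (e : HilbertBasis ι ℂ H) : Function.Injective (j e) := fun v w h =>
  ext fun i => by rw [← j_basis e, h, j_basis]

lemma hasSum_star (e : HilbertBasis ι ℂ H) (A : H →L[ℂ] H) {s : ℝ}
    (h : HasSum (fun i => ‖A (e i)‖ ^ 2) s) : HasSum (fun i => ‖(star A) (e i)‖ ^ 2) s := by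
  have hf : ∀ i, HasSum (fun k => ‖e.repr (A (e i)) k‖ ^ 2) (‖A (e i)‖ ^ 2) :=
    fun i => parseval e _
  have hS : Summable (fun q : ι × ι => ‖e.repr (A (e q.1)) q.2‖ ^ 2) := by
    refine (summable_prod_of_nonneg (fun q => by positivity)).2 ⟨fun i => (hf i).summable, ?_⟩
    simp only [(hf _).tsum_eq]
    exact h.summable
  have h1 := hS.hasSum.prod_fiberwise hf
  have hs := h1.unique h
  have h2 := hS.hasSum
  rw [hs, ← (Equiv.prodComm ι ι).hasSum_iff] at h2
  refine h2.prod_fiberwise fun k => ?_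
  convert parseval e ((star A) (e k)) using 2 with i
  simp only [Function.comp, Equiv.prodComm_apply, Prod.fst_swap, Prod.snd_swap]
  rw [e.repr_apply_apply, e.repr_apply_apply, ContinuousLinearMap.star_eq_adjoint,
    ContinuousLinearMap.adjoint_inner_right, norm_inner_symm]

lemma isHS_star (e : HilbertBasis ι ℂ H) {A : H →L[ℂ] H} (h : IsHS e A) : IsHS e (star A) :=
  (hasSum_star e A h.hasSum).summable

def J0 (e : HilbertBasis ι ℂ H) (v : HSG H ι) : HSG H ι :=
  ofOp e (star (j e v)) (isHS_star e (isHS_j e v))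

lemma j_J0 (e : HilbertBasis ι ℂ H) (v : HSG H ι) : j e (J0 e v) = star (j e v) := j_ofOp _ _ _

lemma norm_J0 (e : HilbertBasis ι ℂ H) (v : HSG H ι) : ‖J0 e v‖ = ‖v‖ := by
  have h1 := hasSum_star e (j e v) (s := ‖v‖ ^ 2) (by simpa only [j_basis] using hasSum v)
  have h2 := (hasSum (J0 e v)).unique h1
  exact (sq_eq_sq₀ (norm_nonneg _) (norm_nonneg _)).1 h2

def J (e : HilbertBasis ι ℂ H) : HSG H ι →ₗᵢ[ℝ] HSG H ι where
  toFun := J0 e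
  map_add' v w := j_inj e (by simp only [j_J0, map_add, star_add])
  map_smul' r v := j_inj e (by simp only [j_J0, map_smul, star_smul, RingHom.id_apply, star_trivial])
  norm_map' := norm_J0 e

lemma j_J (e : HilbertBasis ι ℂ H) (v : HSG H ι) : j e (J e v) = star (j e v) := j_J0 e v

lemma J_J (e : HilbertBasis ι ℂ H) (v : HSG H ι) : J e (J e v) = v :=
  j_inj e (by simp [j_J])

lemma summable_L (a : H →L[ℂ] H) (v : HSG H ι) : Summable fun i => ‖a (c v i)‖ ^ 2 := by
  refine Summable.of_nonneg_of_le (fun i => by positivity) (fun i => ?_)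
    ((hasSum v).summable.mul_left (‖a‖ ^ 2))
  rw [← mul_pow]; gcongr; exact a.le_opNorm _

def L0 (a : H →L[ℂ] H) (v : HSG H ι) : HSG H ι := mk (fun i => a (c v i)) (summable_L a v)

lemma c_L0 (a : H →L[ℂ] H) (v : HSG H ι) (i : ι) : c (L0 a v) i = a (c v i) := rfl

lemma norm_L0 (a : H →L[ℂ] H) (v : HSG H ι) : ‖L0 a v‖ ≤ ‖a‖ * ‖v‖ := by
  refine (sq_le_sq₀ (norm_nonneg _) (by positivity)).1 ?_
  rw [mul_pow, norm_sq, norm_sq, ← tsum_mul_left]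
  refine Summable.tsum_le_tsum (fun i => ?_) (hasSum _).summable
    ((hasSum v).summable.mul_left (‖a‖ ^ 2))
  rw [← mul_pow]; gcongr; exact a.le_opNorm _

def L : (H →L[ℂ] H) →L[ℝ] HSG H ι →L[ℝ] HSG H ι :=
  LinearMap.mkContinuous₂
    (LinearMap.mk₂ ℝ L0 (fun a b v => ext fun i => by simp [c_L0, c_add])
      (fun r a v => ext fun i => by simp [c_L0, c_smul])
      (fun a v w => ext fun i => by simp [c_L0, c_add])
      (fun r a v => ext fun i => by simp [c_L0, c_smul])) 1
    (fun a v => by simpa using norm_L0 a v)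

lemma c_L (a : H →L[ℂ] H) (v : HSG H ι) (i : ι) : c (L a v) i = a (c v i) := rfl

lemma norm_L_apply (a : H →L[ℂ] H) (v : HSG H ι) : ‖L a v‖ ≤ ‖a‖ * ‖v‖ := norm_L0 a v

lemma j_L (e : HilbertBasis ι ℂ H) (a : H →L[ℂ] H) (v : HSG H ι) : j e (L a v) = a * j e v :=
  op_ext e fun i => by simp [j_basis, c_L]

def R (e : HilbertBasis ι ℂ H) : (H →L[ℂ] H) →L[ℝ] HSG H ι →L[ℝ] HSG H ι :=
  LinearMap.mkContinuous₂
    (LinearMap.mk₂ ℝ (fun a v => J e (L (star a) (J e v)))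
      (fun a b v => by simp only [star_add, map_add, add_apply])
      (fun r a v => by simp only [star_smul, star_trivial, map_smul, ContinuousLinearMap.smul_apply])
      (fun a v w => by simp only [map_add])
      (fun r a v => by simp only [map_smul])) 1
    (fun a v => by
      simpa using norm_L_apply (star a) (J e v))

lemma R_apply (e : HilbertBasis ι ℂ H) (a : H →L[ℂ] H) (v : HSG H ι) :
    R e a v = J e (L (star a) (J e v)) := rfl

lemma j_R (e : HilbertBasis ι ℂ H) (a : H →L[ℂ] H) (v : HSG H ι) : j e (R e a v) = j e v * a := by
  rw [R_apply, j_J, j_L, j_J, star_mul, star_star, star_star]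

lemma adj_L (a : H →L[ℂ] H) (v w : HSG H ι) : ⟪L a v, w⟫_ℝ = ⟪v, L (star a) w⟫_ℝ := by
  rw [real_inner, real_inner]
  congr 1
  refine (hasSum_inner _ _).unique ?_
  convert hasSum_inner v (L (star a) w) using 2 with i
  rw [c_L, c_L, ContinuousLinearMap.star_eq_adjoint, ContinuousLinearMap.adjoint_inner_right]

lemma inner_J (e : HilbertBasis ι ℂ H) (v w : HSG H ι) : ⟪J e v, w⟫_ℝ = ⟪v, J e w⟫_ℝ := by
  conv_lhs => rw [← J_J e w]
  exact (J e).inner_map_map v (J e w)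

def data (e : HilbertBasis ι ℂ H) : HSData (H →L[ℂ] H) (HSG H ι) where
  j := j e
  L := L
  R := R e
  inj := j_inj e
  norm_j := norm_op_le e
  j_L := j_L e
  j_R := j_R e
  norm_L a := ContinuousLinearMap.opNorm_le_bound _ (norm_nonneg a) (norm_L_apply a)
  norm_R a := ContinuousLinearMap.opNorm_le_bound _ (norm_nonneg a) (fun v => by
    simpa [R_apply] using norm_L_apply (star a) (J e v))
  adj_L := adj_L
  adj_R a v w := by
    rw [R_apply, R_apply, inner_J, adj_L, inner_J]

end HSG
end concrete

section concrete2
set_option linter.unusedSectionVars false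
open MeasureTheory Filter Topology
namespace HSG

lemma PP_of_memP (e : HilbertBasis ι ℂ H) {p : H →L[ℂ] H} (hp : MemP e p) : (data e).PP p := by
  obtain ⟨h1, h2, h3, h4⟩ := hp
  have hpos : 0 ≤ p := by
    rw [ContinuousLinearMap.nonneg_iff_isPositive]
    exact ⟨ContinuousLinearMap.isSelfAdjoint_iff_isSymmetric.1 h1, h3⟩
  obtain ⟨X, hX, e1, -⟩ := (data e).PP_of (p := p) ⟨hpos, h2⟩ (w := ofOp e (p - 1) h4) (j_ofOp e _ h4)
  exact ⟨X, hX, e1⟩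

lemma memP_of_PP (e : HilbertBasis ι ℂ H) {p : H →L[ℂ] H} (hp : (data e).PP p) : MemP e p := by
  have h := hp.sp
  obtain ⟨w, hw⟩ := hp.sub_one
  have h1 : p.IsPositive := (ContinuousLinearMap.nonneg_iff_isPositive p).1 h.1
  refine ⟨h.1.isSelfAdjoint, h.isUnit, h1.2, ?_⟩
  rw [← hw]; exact isHS_j e w

/-- The coordinate version of a space of operators. -/
def EG (e : HilbertBasis ι ℂ H) (E : Submodule ℝ (H →L[ℂ] H)) : Submodule ℝ (HSG H ι) :=
  E.comap (j e : HSG H ι →ₗ[ℝ] (H →L[ℂ] H))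

lemma mem_EG {e : HilbertBasis ι ℂ H} {E : Submodule ℝ (H →L[ℂ] H)} {v : HSG H ι} :
    v ∈ EG e E ↔ j e v ∈ E := Iff.rfl

lemma LT_EG (e : HilbertBasis ι ℂ H) (E : Submodule ℝ (H →L[ℂ] H))
    (hE : ∀ X ∈ E, MemS2 e X) (hclosed : IsHSClosed e (E : Set (H →L[ℂ] H)))
    (hbrk : ∀ X ∈ E, ∀ Y ∈ E, brk X (brk X Y) ∈ E) : (data e).LT (EG e E) where
  cl := by
    rw [← isSeqClosed_iff_isClosed]
    intro v w hv hw
    have hsa : IsClosed {u : HSG H ι | star (j e u) = j e u} :=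
      isClosed_eq (continuous_star.comp (j e).continuous) (j e).continuous
    have hws : star (j e w) = j e w :=
      hsa.mem_of_tendsto hw (Eventually.of_forall fun n => (hE _ (hv n)).1)
    refine hclosed (j e w) ⟨hws, isHS_j e w⟩ fun ε hε => ?_
    obtain ⟨n, hn⟩ := ((Metric.tendsto_nhds.1 hw) ε hε).exists
    refine ⟨j e (v n), hv n, ?_⟩
    rw [← map_sub, hsNorm_j, ← dist_eq_norm, dist_comm]; exact hn
  sa X hX := (hE _ hX).1
  lt X hX Y hY := by
    have : brk (j e X) (brk (j e X) (j e Y)) ∈ E := hbrk _ hX _ hY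
    rw [mem_EG]
    convert this using 1
    have had : ∀ a u, j e ((data e).ad a u) = j e u * a - a * j e u := fun a u => by
      rw [HSData.ad, sub_apply, map_sub]
      exact congrArg₂ _ (j_R e a u) (j_L e a u)
    rw [had, had, brk, brk]
    change (_ * j e X - j e X * _) * j e X - j e X * (_ * j e X - j e X * _) = _
    noncomm_ring

lemma mem_expSet_E {e : HilbertBasis ι ℂ H} {E : Submodule ℝ (H →L[ℂ] H)}
    (hE : ∀ X ∈ E, MemS2 e X) {a : H →L[ℂ] H} :
    a ∈ expSet (E : Set (H →L[ℂ] H)) ↔ ∃ A ∈ EG e E, NormedSpace.exp ((data e).j A) = a := by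
  constructor
  · rintro ⟨X, hX, rfl⟩
    have := j_ofOp e X (hE X hX).2
    exact ⟨ofOp e X (hE X hX).2, by rw [mem_EG, this]; exact hX, congrArg _ this⟩
  · rintro ⟨A, hA, rfl⟩
    exact ⟨j e A, hA, rfl⟩

lemma mem_expSet_F {e : HilbertBasis ι ℂ H} {E : Submodule ℝ (H →L[ℂ] H)}
    (hE : ∀ X ∈ E, MemS2 e X) {b : H →L[ℂ] H} :
    b ∈ expSet (hsPerp e (E : Set (H →L[ℂ] H))) ↔ ∃ V, (data e).SA V ∧
      (∀ Y ∈ EG e E, ⟪Y, V⟫_ℝ = 0) ∧ NormedSpace.exp ((data e).j V) = b := by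
  constructor
  · rintro ⟨X, ⟨⟨h1, h2⟩, h3⟩, rfl⟩
    have := j_ofOp e X h2
    refine ⟨ofOp e X h2, ?_, fun Y hY => ?_, congrArg _ this⟩
    · change star (j e _) = j e _
      rw [this]; exact h1
    · rw [← hsInner_j e, this]; exact h3 _ hY
  · rintro ⟨V, h1, h2, rfl⟩
    refine ⟨j e V, ⟨⟨h1, isHS_j e V⟩, fun X hX => ?_⟩, rfl⟩
    have := j_ofOp e X (hE X hX).2
    rw [← this, hsInner_j]
    exact h2 _ (by rw [mem_EG, this]; exact hX)

lemma HT_of_lt (e : HilbertBasis ι ℂ H) {x : ℕ → H →L[ℂ] H} {x0 : H →L[ℂ] H}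
    (hx : ∀ n, (data e).PP (x n)) (hx0 : (data e).PP x0)
    (h : ∀ n : ℕ, hsNorm e (x n - x0) < 1 / ((n : ℝ) + 1)) : (data e).HT x atTop x0 := by
  choose w hw using fun n => (hx n).sub_one
  obtain ⟨w0, hw0⟩ := hx0.sub_one
  have hd : ∀ n, j e (w n - w0) = x n - x0 := fun n => by
    have h1 : j e (w n) = _ := hw n
    have h2 : j e w0 = _ := hw0
    rw [map_sub, h1, h2]; abel
  refine ⟨fun n => w n - w0, hd, ?_⟩
  refine squeeze_zero_norm (fun n => ?_) tendsto_one_div_add_atTop_nhds_zero_nat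
  rw [← hsNorm_j e, hd]; exact (h n).le

lemma HT_lt (e : HilbertBasis ι ℂ H) {x : ℕ → H →L[ℂ] H} {x0 : H →L[ℂ] H}
    (h : (data e).HT x atTop x0) {ε : ℝ} (hε : 0 < ε) :
    ∀ᶠ n in atTop, hsNorm e (x n - x0) < ε := by
  obtain ⟨w, hw, t⟩ := h
  filter_upwards [(Metric.tendsto_nhds.1 t) ε hε] with n hn
  rw [← hw n]
  change hsNorm e (j e (w n)) < ε
  rw [hsNorm_j]; simpa using hn

end HSG
end concrete2

/-- **Mostow decomposition of `P`.** With `E ⊆ S₂(H)` a closed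
subspace satisfying `[X,[X,Y]] ∈ E` and `F = E^⊥`, every `p ∈ P` is uniquely
`p = e f e` with `e ∈ exp E`, `f ∈ exp F`, and `(e, f) ↦ e f e` is a homeomorphism
from `exp E × exp F` onto `P` for the Hilbert–Schmidt distance. -/
theorem statement15 (e : HilbertBasis ι ℂ H) (E : Submodule ℝ (H →L[ℂ] H))
    (hE : ∀ X ∈ E, MemS2 e X) (hclosed : IsHSClosed e (E : Set (H →L[ℂ] H)))
    (hbrk : ∀ X ∈ E, ∀ Y ∈ E, brk X (brk X Y) ∈ E) :
    (∀ a ∈ expSet (E : Set (H →L[ℂ] H)), ∀ b ∈ expSet (hsPerp e (E : Set (H →L[ℂ] H))),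
      MemP e (a * b * a)) ∧
    (∀ p : H →L[ℂ] H, MemP e p → ∃! ef : (H →L[ℂ] H) × (H →L[ℂ] H),
      ef.1 ∈ expSet (E : Set (H →L[ℂ] H)) ∧
      ef.2 ∈ expSet (hsPerp e (E : Set (H →L[ℂ] H))) ∧
      p = ef.1 * ef.2 * ef.1) ∧
    (∀ a ∈ expSet (E : Set (H →L[ℂ] H)), ∀ b ∈ expSet (hsPerp e (E : Set (H →L[ℂ] H))),
      ∀ ε > (0:ℝ), ∃ δ > (0:ℝ),
        ∀ a' ∈ expSet (E : Set (H →L[ℂ] H)), ∀ b' ∈ expSet (hsPerp e (E : Set (H →L[ℂ] H))),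
          hsNorm e (a' - a) < δ → hsNorm e (b' - b) < δ →
            hsNorm e (a' * b' * a' - a * b * a) < ε) ∧
    (∀ a ∈ expSet (E : Set (H →L[ℂ] H)), ∀ b ∈ expSet (hsPerp e (E : Set (H →L[ℂ] H))),
      ∀ ε > (0:ℝ), ∃ δ > (0:ℝ),
        ∀ a' ∈ expSet (E : Set (H →L[ℂ] H)), ∀ b' ∈ expSet (hsPerp e (E : Set (H →L[ℂ] H))),
          hsNorm e (a' * b' * a' - a * b * a) < δ →
            hsNorm e (a' - a) < ε ∧ hsNorm e (b' - b) < ε) := by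
  have hLT := HSG.LT_EG e E hE hclosed hbrk
  have ppE : ∀ a ∈ expSet (E : Set (H →L[ℂ] H)), (HSG.data e).PP a := fun a ha => by
    obtain ⟨A, hA, rfl⟩ := (HSG.mem_expSet_E hE).1 ha
    exact ⟨A, hLT.sa A hA, rfl⟩
  have ppF : ∀ b ∈ expSet (hsPerp e (E : Set (H →L[ℂ] H))), (HSG.data e).PP b := fun b hb => by
    obtain ⟨V, hV, -, rfl⟩ := (HSG.mem_expSet_F hE).1 hb
    exact ⟨V, hV, rfl⟩
  refine ⟨fun a ha b hb => HSG.memP_of_PP e ((ppE a ha).conj (ppF b hb)), ?_, ?_, ?_⟩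
  · intro p hp
    obtain ⟨A, hA, V, sV, hV, h⟩ := hLT.exists_decomp (HSG.PP_of_memP e hp)
    refine ⟨(NormedSpace.exp ((HSG.data e).j A), NormedSpace.exp ((HSG.data e).j V)),
      ⟨(HSG.mem_expSet_E hE).2 ⟨A, hA, rfl⟩, (HSG.mem_expSet_F hE).2 ⟨V, sV, hV, rfl⟩, h⟩, ?_⟩
    rintro ⟨a, b⟩ ⟨ha, hb, hab⟩
    obtain ⟨A', hA', rfl⟩ := (HSG.mem_expSet_E hE).1 ha
    obtain ⟨V', sV', hV', rfl⟩ := (HSG.mem_expSet_F hE).1 hb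
    obtain ⟨h1, h2⟩ := hLT.unique hA hA' sV hV sV' hV' (h.symm.trans hab)
    exact Prod.ext (by rw [h1]) h2
  · intro a ha b hb ε hε
    by_contra hcon
    push Not at hcon
    choose a' ha' b' hb' h1 h2 h3 using fun n : ℕ =>
      hcon (1 / ((n : ℝ) + 1)) (by positivity)
    have t1 := HSG.HT_of_lt e (fun n => ppE _ (ha' n)) (ppE a ha) h1
    have t2 := HSG.HT_of_lt e (fun n => ppF _ (hb' n)) (ppF b hb) h2
    obtain ⟨n, hn⟩ := (HSG.HT_lt e ((t1.mul t2).mul t1) hε).exists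
    exact absurd hn (not_lt.2 (h3 n))
  · intro a ha b hb ε hε
    by_contra hcon
    push Not at hcon
    choose a' ha' b' hb' h1 h3 using fun n : ℕ =>
      hcon (1 / ((n : ℝ) + 1)) (by positivity)
    have t1 := HSG.HT_of_lt e (fun n => (ppE _ (ha' n)).conj (ppF _ (hb' n)))
      ((ppE a ha).conj (ppF b hb)) h1
    obtain ⟨A, hA, rfl⟩ := (HSG.mem_expSet_E hE).1 ha
    obtain ⟨V, sV, hV, rfl⟩ := (HSG.mem_expSet_F hE).1 hb
    choose A' hA' eA' using fun n => (HSG.mem_expSet_E hE).1 (ha' n)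
    choose V' sV' hV' eV' using fun n => (HSG.mem_expSet_F hE).1 (hb' n)
    simp only [← eA', ← eV'] at t1
    obtain ⟨u1, u2⟩ := hLT.cont_inv hA sV hV hA' sV' hV' t1
    simp only [eA', eV'] at u1 u2
    obtain ⟨n, hn1, hn2⟩ := ((HSG.HT_lt e u1 hε).and (HSG.HT_lt e u2 hε)).exists
    exact absurd hn2 (not_lt.2 (h3 n hn1))
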